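/- arXiv:math/0404159 — 2 statements merged into one kernel-verified Lean document; each statement's English description precedes it below -/
import Mathlib

section
/- Let A be an associative unital ring, let n ≥ 2, and let f(i,j) ∈ A be given for i ∈ {0,1,…,n} and j ∈ {1,…,n}, such that f(i,j)·f(k,l) = f(k,l)·f(i,j) whenever j ≠ l (elements with different second index commute). For subsets I ⊆ {0,…,n} and J ⊆ {1,…,n} of the same cardinality, set Δ_{I,J} = Σ_σ sgn(σ) Π_{i∈I} f(i,σ(i)), where σ ranges over all bijections from I to J, sgn(σ) is computed via the order-preserving identifications of I and J with {1,…,|I|}, and the product is taken over i ∈ I in increasing order (each monomial is order-independent since its factors pairwise commute). Assume all the Δ_{I,J} with |I| = |J| ≥ 1 are invertible in A. For i ∈ {0,…,n}, set Δ_i = Δ_{{0,…,n}∖{i},{1,…,n}}. Then the elements H_i = (Δ_0)^{-1}·Δ_i, for i = 1,…,n, pairwise commute: H_i·H_j = H_j·H_i for all i,j. -/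
/-- For `I ⊆ {0,…,n}` and `J ⊆ {1,…,n}` with `|I| = |J| = m`, the determinant
`Δ_{I,J} = Σ_σ sgn(σ) Π_{i ∈ I} f(i, σ(i))`, where `σ` ranges over bijections
`I → J` (parametrized via the order-preserving identifications
`Finset.orderIsoOfFin` of `I` and `J` with `Fin m` by permutations of `Fin m`,
whose sign is the sign of `σ`), and the product is taken over `i ∈ I` in
increasing order. -/
noncomputable def deltaIJ {A : Type*} [Ring A] {N : ℕ}
    (f : Fin (N + 1) → Fin N → A) {m : ℕ}
    (I : Finset (Fin (N + 1))) (J : Finset (Fin N))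
    (hI : I.card = m) (hJ : J.card = m) : A :=
  ∑ π : Equiv.Perm (Fin m),
    ((Equiv.Perm.sign π : ℤ) : A) *
      (List.ofFn fun r : Fin m =>
        f (I.orderIsoOfFin hI r) (J.orderIsoOfFin hJ (π r))).prod

/-- `Δ_i = Δ_{{0,…,n}∖{i}, {1,…,n}}`. -/
noncomputable def deltaErase {A : Type*} [Ring A] {n : ℕ}
    (f : Fin (n + 1) → Fin n → A) (i : Fin (n + 1)) : A :=
  deltaIJ f (Finset.univ.erase i) Finset.univ
    (by rw [Finset.card_erase_of_mem (Finset.mem_univ i)]) (by simp)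

section Helpers

open Function

variable {A : Type*} [Ring A]

/-- The determinant with monomials ordered by the second index, as an alternating map in the
vectors `v k`. -/
noncomputable def altD (A : Type*) [Ring A] (n : ℕ) : (Fin n → A) [⋀^Fin n]→ₗ[ℤ] A :=
  MultilinearMap.alternatization
    ((MultilinearMap.mkPiAlgebraFin ℤ n A).compLinearMap
      (fun j => (LinearMap.proj j : (Fin n → A) →ₗ[ℤ] A)))

theorem altD_apply {n : ℕ} (v : Fin n → Fin n → A) :
    altD A n v = ∑ σ : Equiv.Perm (Fin n),
      Equiv.Perm.sign σ • (List.ofFn fun j => v (σ j) j).prod := by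
  unfold altD
  rw [MultilinearMap.alternatization_apply]
  rfl

theorem prod_ofFn_update {n : ℕ} (g : Fin n → A) (j : Fin n) (x : A)
    (h : ∀ l, l ≠ j → Commute (g l) x) :
    (List.ofFn (update g j x)).prod = (List.ofFn (update g j 1)).prod * x := by
  induction n with
  | zero => exact j.elim0
  | succ n ih =>
    rw [List.ofFn_succ, List.ofFn_succ, List.prod_cons, List.prod_cons]
    refine Fin.cases ?_ (fun j' => ?_) j (motive := fun j => (∀ l, l ≠ j → Commute (g l) x) → update g j x 0 * (List.ofFn fun i => update g j x (Fin.succ i)).prod =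
      update g j 1 0 * (List.ofFn fun i => update g j 1 (Fin.succ i)).prod * x) h
    · intro h
      simp only [update_self, one_mul, ne_eq, Fin.succ_ne_zero, not_false_eq_true, update_of_ne]
      refine (Commute.list_prod_right _ _ ?_)
      intro y hy
      obtain ⟨i, rfl⟩ := (List.mem_ofFn' _ _).1 hy
      exact (h _ (Fin.succ_ne_zero i)).symm
    · intro h
      have key : ∀ y : A, (fun i => update g j'.succ y (Fin.succ i))
          = update (fun i => g (Fin.succ i)) j' y := by
        intro y
        ext i
        by_cases hi : i = j'
        · subst hi; simp
        · rw [update_of_ne hi, update_of_ne (by simpa using hi)]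
      rw [key, key, ih _ _ (fun l hl => h _ (by simpa using hl)), mul_assoc,
        update_of_ne (Fin.succ_ne_zero _).symm, update_of_ne (Fin.succ_ne_zero _).symm]

theorem prod_ofFn_zero {n : ℕ} (g : Fin n → A) (j : Fin n) (h : g j = 0) :
    (List.ofFn g).prod = 0 :=
  List.prod_eq_zero ((List.mem_ofFn' _ _).2 ⟨j, h⟩)

theorem altD_single {n : ℕ} (v : Fin n → Fin n → A) (i j : Fin n) (x : A)
    (h : ∀ k l, k ≠ i → l ≠ j → Commute (v k l) x) :
    altD A n (update v i (Pi.single j x)) = altD A n (update v i (Pi.single j 1)) * x := by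
  rw [altD_apply, altD_apply, Finset.sum_mul]
  refine Finset.sum_congr rfl fun σ _ => ?_
  rw [smul_mul_assoc]
  congr 1
  by_cases hσ : σ j = i
  · have key : ∀ y : A, (fun l => update v i (Pi.single j y) (σ l) l)
        = update (fun l => if l = j then 0 else v (σ l) l) j y := by
      intro y
      ext l
      by_cases hl : l = j
      · subst hl; simp [hσ]
      · have : σ l ≠ i := fun h' => hl (σ.injective (h'.trans hσ.symm))
        rw [update_of_ne this, update_of_ne hl, if_neg hl]
    rw [key, key, prod_ofFn_update]
    intro l hl
    rw [if_neg hl]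
    exact h _ _ (fun h' => hl (σ.injective (h'.trans hσ.symm))) hl
  · have hne : σ.symm i ≠ j := fun h' => hσ (by rw [← h']; simp)
    rw [prod_ofFn_zero _ (σ.symm i), prod_ofFn_zero _ (σ.symm i), zero_mul]
    · simp [hne]
    · simp [hne]

theorem altD_single_single {n : ℕ} (v : Fin n → Fin n → A) (i k j : Fin n) (hik : i ≠ k)
    (x y : A) :
    altD A n (update (update v i (Pi.single j x)) k (Pi.single j y)) = 0 := by
  rw [altD_apply]
  refine Finset.sum_eq_zero fun σ _ => ?_
  by_cases hσ : σ j = i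
  · have hne : σ.symm k ≠ j := fun h' => hik (by rw [← hσ, ← h']; simp)
    rw [prod_ofFn_zero _ (σ.symm k), smul_zero]
    simp [hne]
  · have hne : σ.symm i ≠ j := fun h' => hσ (by rw [← h']; simp)
    rw [prod_ofFn_zero _ (σ.symm i), smul_zero]
    simp [hne, hik]

/-- Expansion along the `i`-th vector. -/
theorem altD_expand {n : ℕ} (v : Fin n → Fin n → A) (i : Fin n) (w : Fin n → A)
    (h : ∀ k l j, k ≠ i → l ≠ j → Commute (v k l) (w j)) :
    altD A n (update v i w) = ∑ j, altD A n (update v i (Pi.single j 1)) * w j := by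
  conv_lhs => rw [← Finset.univ_sum_single w, AlternatingMap.map_update_sum]
  refine Finset.sum_congr rfl fun j _ => ?_
  exact altD_single _ _ _ _ fun k l hk hl => h _ _ _ hk hl

theorem altD_expand_two {n : ℕ} (v : Fin n → Fin n → A) (i k : Fin n) (hik : i ≠ k)
    (w z : Fin n → A)
    (h : ∀ a l j, l ≠ j → Commute (v a l) (w j))
    (h' : ∀ a l j, l ≠ j → Commute (v a l) (z j))
    (hwz : ∀ l j, l ≠ j → Commute (w l) (z j)) :
    altD A n (update (update v i w) k z) =
      ∑ l, ∑ j, altD A n (update (update v i (Pi.single j 1)) k (Pi.single l 1)) *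
        (w j * z l) := by
  rw [altD_expand]
  · refine Finset.sum_congr rfl fun l _ => ?_
    rw [update_comm hik]
    conv_lhs => rw [← Finset.univ_sum_single w, AlternatingMap.map_update_sum]
    rw [Finset.sum_mul]
    refine Finset.sum_congr rfl fun j _ => ?_
    by_cases hlj : l = j
    · subst hlj
      rw [altD_single_single _ _ _ _ hik.symm, altD_single_single _ _ _ _ hik]
      simp
    · rw [altD_single, update_comm hik, mul_assoc]
      intro a b ha hb
      by_cases hak : a = k
      · subst hak
        rw [update_self]
        by_cases hbl : b = l
        · subst hbl; simp
        · simp [hbl]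
      · rw [update_of_ne hak]
        exact h _ _ _ hb
  · intro a l j ha hl
    by_cases hai : a = i
    · subst hai
      rw [update_self]; exact hwz _ _ hl
    · rw [update_of_ne hai]; exact h' _ _ _ hl

theorem altD_repl {n : ℕ} (u : Fin n → Fin n → A) (i k : Fin n) :
    altD A n (update u i (u k)) = if k = i then altD A n u else 0 := by
  split_ifs with h
  · subst h; simp
  · exact AlternatingMap.map_update_self _ _ (Ne.symm h)

/-- Cramer. -/
theorem cramer_aux {n : ℕ} (u : Fin n → Fin n → A) (V G : Fin n → A)
    (hu : ∀ i k j l, j ≠ l → Commute (u i j) (u k l))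
    (huV : ∀ i j l, j ≠ l → Commute (u i j) (V l))
    (hG : ∀ j, V j = ∑ k, u k j * G k) (i : Fin n) :
    altD A n (update u i V) = altD A n u * G i := by
  rw [altD_expand _ _ _ (fun k l j _ h => huV k l j h)]
  simp_rw [hG, Finset.mul_sum, ← mul_assoc]
  rw [Finset.sum_comm]
  simp_rw [← Finset.sum_mul]
  have : ∀ k, ∑ j, altD A n (update u i (Pi.single j 1)) * u k j
      = if k = i then altD A n u else 0 := fun k => by
    rw [← altD_repl, altD_expand _ _ _ (fun a l j _ h => hu a k l j h)]
  simp_rw [this]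
  simp

theorem commutator_aux {n : ℕ} (u : Fin n → Fin n → A) (V G : Fin n → A)
    (hu : ∀ i k j l, j ≠ l → Commute (u i j) (u k l))
    (huV : ∀ i j l, j ≠ l → Commute (u i j) (V l))
    (hV : ∀ j l, j ≠ l → Commute (V j) (V l))
    (hG : ∀ j, V j = ∑ k, u k j * G k) (i k : Fin n) (hik : i ≠ k) :
    altD A n u * (G i * G k - G k * G i) = 0 := by
  have h0 : altD A n (update (update u i V) k V) = 0 := by
    refine AlternatingMap.map_eq_zero_of_eq _ _ (i := i) (j := k) ?_ hik
    simp [hik]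
  rw [altD_expand_two _ _ _ hik _ _ huV huV hV] at h0
  have h1 : ∀ l j, altD A n (update (update u i (Pi.single j 1)) k (Pi.single l 1)) * (V j * V l)
      = ∑ a, ∑ b, altD A n (update (update u i (Pi.single j 1)) k (Pi.single l 1)) *
        (u a j * u b l) * (G a * G b) := by
    intro l j
    by_cases hlj : l = j
    · subst hlj
      simp [altD_single_single _ _ _ _ hik]
    · have : V j * V l = ∑ a, ∑ b, (u a j * u b l) * (G a * G b) := by
        conv_lhs => rw [hG l, Finset.mul_sum]
        rw [Finset.sum_comm]
        refine Finset.sum_congr rfl fun b _ => ?_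
        rw [← mul_assoc, ← (huV b l j hlj).eq, hG j, Finset.mul_sum, Finset.sum_mul]
        refine Finset.sum_congr rfl fun a _ => ?_
        rw [← mul_assoc, (hu b a l j hlj).eq]
        simp only [mul_assoc]
      rw [this]
      simp only [Finset.mul_sum, mul_assoc]
  simp_rw [h1] at h0
  have h2 : ∀ a b, ∑ l, ∑ j, altD A n (update (update u i (Pi.single j 1)) k (Pi.single l 1)) *
        (u a j * u b l) = altD A n (update (update u i (u a)) k (u b)) := fun a b =>
    (altD_expand_two _ _ _ hik _ _ (fun c l j h => hu c a l j h) (fun c l j h => hu c b l j h)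
      (fun l j h => hu a b l j h)).symm
  have h3 : ∑ a, ∑ b, altD A n (update (update u i (u a)) k (u b)) * (G a * G b) = 0 := by
    rw [← h0]
    simp_rw [← h2, Finset.sum_mul]
    calc _ = ∑ a, ∑ l, ∑ b, ∑ j, altD A n (update (update u i (Pi.single j 1)) k (Pi.single l 1)) *
        (u a j * u b l) * (G a * G b) := Finset.sum_congr rfl fun a _ => Finset.sum_comm
      _ = ∑ l, ∑ a, ∑ b, ∑ j, altD A n (update (update u i (Pi.single j 1)) k (Pi.single l 1)) *
        (u a j * u b l) * (G a * G b) := Finset.sum_comm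
      _ = ∑ l, ∑ a, ∑ j, ∑ b, altD A n (update (update u i (Pi.single j 1)) k (Pi.single l 1)) *
        (u a j * u b l) * (G a * G b) := Finset.sum_congr rfl fun l _ =>
          Finset.sum_congr rfl fun a _ => Finset.sum_comm
      _ = _ := Finset.sum_congr rfl fun l _ => Finset.sum_comm
  have hz : ∀ a b, ¬ (a = i ∧ b = k) → ¬ (a = k ∧ b = i) →
      altD A n (update (update u i (u a)) k (u b)) = 0 := by
    intro a b h1 h2
    by_cases hab : a = b
    · refine AlternatingMap.map_eq_zero_of_eq _ _ (i := i) (j := k) ?_ hik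
      simp [hik, hab]
    · by_cases ha : a ≠ i ∧ a ≠ k
      · refine AlternatingMap.map_eq_zero_of_eq _ _ (i := i) (j := a) ?_ ha.1.symm
        simp [hik, ha.1, ha.2]
      · have hb : b ≠ i ∧ b ≠ k := by grind
        refine AlternatingMap.map_eq_zero_of_eq _ _ (i := k) (j := b) ?_ hb.2.symm
        simp [hb.1, hb.2]
  have hs : altD A n (update (update u i (u k)) k (u i)) = - altD A n u := by
    rw [← AlternatingMap.map_swap _ _ hik]
    congr 1
    ext a : 1
    by_cases hak : a = k
    · subst hak; simp
    · by_cases hai : a = i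
      · subst hai; simp [hak]
      · simp [hak, hai, Equiv.swap_apply_of_ne_of_ne]
  rw [Finset.sum_eq_add i k hik, Finset.sum_eq_single k, Finset.sum_eq_single i, hs] at h3
  · rw [mul_sub, sub_eq_add_neg, ← neg_mul]
    rwa [update_eq_self, update_eq_self] at h3
  · intro b _ hb; rw [hz _ _ (by grind) (by grind), zero_mul]
  · simp
  · intro b _ hb; rw [hz _ _ (by grind) (by grind), zero_mul]
  · simp
  · intro a _ ha
    refine Finset.sum_eq_zero fun b _ => ?_
    rw [hz _ _ (by grind) (by grind), zero_mul]
  · simp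
  · simp

theorem altD_corner {m : ℕ} (u : Fin (m + 1) → Fin (m + 1) → A) :
    altD A (m + 1) (update u 0 (Pi.single 0 1)) =
      altD A m (fun k j => u k.succ j.succ) := by
  rw [altD_apply, altD_apply, ← Equiv.sum_comp Equiv.Perm.decomposeFin.symm,
    Fintype.sum_prod_type, Finset.sum_eq_single 0]
  · refine Finset.sum_congr rfl fun σ _ => ?_
    rw [List.ofFn_succ, List.prod_cons, Equiv.Perm.decomposeFin.symm_sign]
    simp [Equiv.Perm.decomposeFin_symm_apply_succ]
  · intro p _ hp
    refine Finset.sum_eq_zero fun σ _ => ?_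
    set τ := Equiv.Perm.decomposeFin.symm (p, σ) with hτ
    have h0 : τ 0 = p := by simp [hτ]
    have hne : τ.symm 0 ≠ 0 := fun h' => hp (by rw [← h0]; conv_lhs => rw [← h']; simp)
    rw [prod_ofFn_zero _ (τ.symm 0), smul_zero]
    simp [hne]
  · simp

theorem solve_aux {m : ℕ} (u : Fin m → Fin m → A)
    (hu : ∀ i k j l, j ≠ l → Commute (u i j) (u k l))
    (hunit : ∀ (r : ℕ) (e₁ e₂ : Fin r ↪o Fin m),
      IsUnit (altD A r (fun k j => u (e₁ k) (e₂ j)))) (V : Fin m → A) :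
    ∃ G : Fin m → A, ∀ j, V j = ∑ k, u k j * G k := by
  induction m with
  | zero => exact ⟨V, fun j => j.elim0⟩
  | succ m ih =>
    have ih' := ih (fun k j => u k.succ j.succ)
      (fun i k j l h => hu _ _ _ _ (by simpa using h))
      (fun r e₁ e₂ => hunit r (e₁.trans (Fin.succOrderEmb m)) (e₂.trans (Fin.succOrderEmb m)))
    obtain ⟨h, hh⟩ := ih' (fun j => u 0 j.succ)
    obtain ⟨g, hg⟩ := ih' (fun j => V j.succ)
    have hD : IsUnit (altD A (m + 1) u) := hunit (m + 1) (RelEmbedding.refl _) (RelEmbedding.refl _)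
    have hD' : IsUnit (altD A m (fun k j => u k.succ j.succ)) :=
      hunit m (Fin.succOrderEmb m) (Fin.succOrderEmb m)
    set s : A := u 0 0 - ∑ k : Fin m, u k.succ 0 * h k with hs
    have hrel : ∀ k, ∑ j, altD A (m + 1) (update u 0 (Pi.single j 1)) * u k j
      = if k = 0 then altD A (m + 1) u else 0 := fun k => by
      rw [← altD_repl, altD_expand _ _ _ (fun a l j _ h => hu a k l j h)]
    have hLs : altD A m (fun k j => u k.succ j.succ) * s = altD A (m + 1) u := by
      have e0 := hrel 0
      rw [if_pos rfl, Fin.sum_univ_succ, altD_corner] at e0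
      have e1 : ∑ k : Fin m, (∑ j, altD A (m + 1) (update u 0 (Pi.single j 1)) * u k.succ j) * h k
          = 0 := Finset.sum_eq_zero fun k _ => by
        rw [hrel, if_neg (Fin.succ_ne_zero _), zero_mul]
      simp_rw [Fin.sum_univ_succ, altD_corner, add_mul, Finset.sum_add_distrib, Finset.sum_mul] at e1
      rw [Finset.sum_comm] at e1
      simp_rw [mul_assoc, ← Finset.mul_sum, ← hh] at e1
      rw [hs, mul_sub, ← e0, sub_eq_iff_eq_add, add_assoc, add_comm (Finset.sum _ _), e1, add_zero]
    have hsu : IsUnit s := by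
      obtain ⟨d, hd⟩ := hD'
      rw [← hd] at hLs
      have : s = ↑d⁻¹ * altD A (m + 1) u := by rw [← hLs]; simp
      rw [this]
      exact (Units.isUnit _).mul hD
    obtain ⟨s', hs'⟩ := hsu
    set t : A := ↑s'⁻¹ * (V 0 - ∑ k : Fin m, u k.succ 0 * g k) with ht
    have hst : s * t = V 0 - ∑ k : Fin m, u k.succ 0 * g k := by
      rw [ht, ← hs', Units.mul_inv_cancel_left]
    refine ⟨Fin.cons t (fun k => g k - h k * t), fun j => ?_⟩
    rw [Fin.sum_univ_succ]
    simp only [Fin.cons_zero, Fin.cons_succ, mul_sub, Finset.sum_sub_distrib, ← mul_assoc,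
      ← Finset.sum_mul]
    refine Fin.cases ?_ (fun j' => ?_) j
    · rw [hs, sub_mul, eq_sub_iff_add_eq] at hst
      rw [← hst]; abel
    · rw [← hg, ← hh]; abel

theorem deltaIJ_eq {N : ℕ} (f : Fin (N + 1) → Fin N → A)
    (hcomm : ∀ (i k : Fin (N + 1)) (j l : Fin N), j ≠ l →
      f i j * f k l = f k l * f i j) {m : ℕ}
    (I : Finset (Fin (N + 1))) (J : Finset (Fin N))
    (hI : I.card = m) (hJ : J.card = m) (e₁ : Fin m → Fin (N + 1)) (e₂ : Fin m → Fin N)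
    (h₁ : StrictMono e₁) (h₂ : StrictMono e₂) (m₁ : ∀ x, e₁ x ∈ I) (m₂ : ∀ x, e₂ x ∈ J) :
    deltaIJ f I J hI hJ = altD A m (fun k j => f (e₁ k) (e₂ j)) := by
  rw [altD_apply]
  unfold deltaIJ
  simp only [Finset.coe_orderIsoOfFin_apply, ← Finset.orderEmbOfFin_unique hI m₁ h₁,
    ← Finset.orderEmbOfFin_unique hJ m₂ h₂]
  rw [← Equiv.sum_comp (Equiv.inv (Equiv.Perm (Fin m)))]
  refine Finset.sum_congr rfl fun σ _ => ?_
  have hp : (List.ofFn fun j => f (e₁ (σ j)) (e₂ j)).prod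
      = (List.ofFn fun r => f (e₁ r) (e₂ (σ⁻¹ r))).prod := by
    refine List.Perm.prod_eq' ?_ ?_
    · have := Equiv.Perm.ofFn_comp_perm σ (fun r => f (e₁ r) (e₂ (σ⁻¹ r)))
      simpa [Function.comp_def] using this
    · rw [List.pairwise_ofFn]
      intro i j hij
      exact hcomm _ _ _ _ (h₂.injective.ne hij.ne)
  simp only [Equiv.inv_apply, Equiv.Perm.sign_inv]
  rw [hp, Units.smul_def, zsmul_eq_mul]

theorem deltaErase_eq {n : ℕ} (f : Fin (n + 1) → Fin n → A)
    (hcomm : ∀ (i k : Fin (n + 1)) (j l : Fin n), j ≠ l →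
      f i j * f k l = f k l * f i j) (i : Fin (n + 1)) :
    deltaErase f i = altD A n (fun k j => f (i.succAbove k) j) := by
  have key : ∀ (m : ℕ) (hm : m = n) (hI : (Finset.univ.erase i).card = m)
      (hJ : (Finset.univ : Finset (Fin n)).card = m),
      deltaIJ f (Finset.univ.erase i) Finset.univ hI hJ
        = altD A n (fun k j => f (i.succAbove k) j) := by
    intro m hm hI hJ
    subst hm
    exact deltaIJ_eq f hcomm _ _ hI hJ i.succAbove id (Fin.strictMono_succAbove i) strictMono_id
      (fun x => by simp [Fin.succAbove_ne]) (fun x => by simp)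
  unfold deltaErase
  exact key _ (by simp) _ _

theorem deltaErase_succ {n : ℕ} (f : Fin (n + 1) → Fin n → A)
    (hcomm : ∀ (i k : Fin (n + 1)) (j l : Fin n), j ≠ l →
      f i j * f k l = f k l * f i j) (i : Fin n) :
    deltaErase f i.succ = Equiv.Perm.sign i.cycleRange •
      altD A n (update (fun k => f k.succ) i (f 0)) := by
  rw [deltaErase_eq f hcomm]
  have h := AlternatingMap.map_perm (altD A n) (fun k j => f (i.succ.succAbove k) j) i.cycleRange
  have h2 : (fun k j => f (i.succ.succAbove k) j) ∘ i.cycleRange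
      = update (fun k => f k.succ) i (f 0) := by
    ext k : 1
    simp only [Function.comp_apply, Fin.succAbove_cycleRange]
    by_cases hk : k = i
    · subst hk; simp
    · rw [update_of_ne hk, Equiv.swap_apply_of_ne_of_ne (Fin.succ_ne_zero _) (by simpa using hk)]
  rw [h2] at h
  rw [h, smul_smul, Int.units_mul_self, one_smul]

end Helpers

theorem commuting_family_from_invertible_minors
    {A : Type*} [Ring A] (n : ℕ) (hn : 2 ≤ n)
    (f : Fin (n + 1) → Fin n → A)
    (hcomm : ∀ (i k : Fin (n + 1)) (j l : Fin n), j ≠ l →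
      f i j * f k l = f k l * f i j)
    (hunit : ∀ (m : ℕ), 1 ≤ m →
      ∀ (I : Finset (Fin (n + 1))) (J : Finset (Fin n))
        (hI : I.card = m) (hJ : J.card = m), IsUnit (deltaIJ f I J hI hJ)) :
    ∀ i j : Fin (n + 1),
      Ring.inverse (deltaErase f 0) * deltaErase f i *
          (Ring.inverse (deltaErase f 0) * deltaErase f j) =
        Ring.inverse (deltaErase f 0) * deltaErase f j *
          (Ring.inverse (deltaErase f 0) * deltaErase f i) := by
  set u : Fin n → Fin n → A := fun k => f k.succ with hu_def
  have hu : ∀ i k j l, j ≠ l → Commute (u i j) (u k l) := fun i k j l h => hcomm _ _ _ _ h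
  have hD0 : deltaErase f 0 = altD A n u := by
    rw [deltaErase_eq f hcomm]; simp [hu_def]
  have hun : ∀ (r : ℕ) (e₁ e₂ : Fin r ↪o Fin n),
      IsUnit (altD A r (fun k j => u (e₁ k) (e₂ j))) := by
    intro r e₁ e₂
    rcases Nat.eq_zero_or_pos r with rfl | hr
    · simp [altD_apply]
    · have hinj : Function.Injective fun k => (e₁ k).succ :=
        (Fin.succ_injective n).comp e₁.injective
      have h := hunit r hr (Finset.univ.image fun k => (e₁ k).succ) (Finset.univ.image e₂)
        (by rw [Finset.card_image_of_injective _ hinj]; simp)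
        (by rw [Finset.card_image_of_injective _ e₂.injective]; simp)
      rw [deltaIJ_eq f hcomm (Finset.univ.image fun k => (e₁ k).succ) (Finset.univ.image e₂) _ _ (fun k => (e₁ k).succ) e₂
        (fun a b hab => Fin.succ_lt_succ_iff.2 (e₁.strictMono hab)) e₂.strictMono
        (fun x => Finset.mem_image.2 ⟨x, Finset.mem_univ x, rfl⟩)
        (fun x => Finset.mem_image.2 ⟨x, Finset.mem_univ x, rfl⟩)] at h
      exact h
  have hD : IsUnit (altD A n u) := hun n (RelEmbedding.refl _) (RelEmbedding.refl _)
  obtain ⟨G, hG⟩ := solve_aux u hu hun (f 0)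
  have hcom : ∀ i k, Commute (G i) (G k) := by
    intro i k
    by_cases hik : i = k
    · subst hik; exact Commute.refl _
    · have h := commutator_aux u (f 0) G hu (fun i j l h => hcomm _ _ _ _ h)
        (fun j l h => hcomm _ _ _ _ h) hG i k hik
      rw [hD.mul_right_eq_zero] at h
      exact sub_eq_zero.1 h
  have hH : ∀ i : Fin n, Ring.inverse (deltaErase f 0) * deltaErase f i.succ
      = ((Equiv.Perm.sign i.cycleRange : ℤ) : A) * G i := by
    intro i
    rw [deltaErase_succ f hcomm, hD0, cramer_aux u (f 0) G hu (fun i j l h => hcomm _ _ _ _ h) hG,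
      Units.smul_def, mul_smul_comm, Ring.inverse_mul_cancel_left _ _ hD, zsmul_eq_mul]
  have hH0 : Ring.inverse (deltaErase f 0) * deltaErase f 0 = 1 := by
    rw [hD0]; exact Ring.inverse_mul_cancel _ hD
  have hfin : ∀ i j, Commute (Ring.inverse (deltaErase f 0) * deltaErase f i)
      (Ring.inverse (deltaErase f 0) * deltaErase f j) := by
    intro i j
    refine Fin.cases ?_ (fun i => ?_) i
    · rw [hH0]; exact Commute.one_left _
    refine Fin.cases ?_ (fun j => ?_) j
    · rw [hH0]; exact Commute.one_right _
    rw [hH, hH]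
    exact (Int.cast_commute _ _).mul_left ((Int.cast_commute _ _).symm.mul_right (hcom i j))
  exact fun i j => hfin i j
end

section
/- Let τ ∈ ℂ with Im τ > 0, let θ: ℂ → ℂ be an order-1 theta function (holomorphic, not identically zero, θ(z+1) = θ(z) and θ(z+τ) = −exp(−2πiz)·θ(z) for all z), let n ≥ 1, and let η ∈ ℂ. Let α, β ≥ 1, f ∈ F_α and g ∈ F_β. Then there exists a unique h ∈ F_{α+β} such that for every point (z_1,…,z_{α+β}) ∈ ℂ^{α+β} with θ(z_i − z_j) ≠ 0 for all i ≠ j, one has h(z_1,…,z_{α+β}) = (1/(α!·β!)) Σ_{σ ∈ S_{α+β}} f(z_{σ(1)}+βη, …, z_{σ(α)}+βη) · g(z_{σ(α+1)}−αη, …, z_{σ(α+β)}−αη) · Π_{1 ≤ i ≤ α < j ≤ α+β} θ(z_{σ(i)} − z_{σ(j)} − nη)/θ(z_{σ(i)} − z_{σ(j)}). -/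
/-- The space `F_α` of holomorphic symmetric functions of `α` variables with
the quasi-periodicity properties of theta functions of order `n`
(for symmetric functions, imposing the quasi-periodicity in each variable is
the same as imposing it in the first variable). -/
def InThetaF (τ : ℂ) (n : ℕ) (α : ℕ) (f : (Fin α → ℂ) → ℂ) : Prop :=
  Differentiable ℂ f ∧
  (∀ (σ : Equiv.Perm (Fin α)) (z : Fin α → ℂ), f (fun r => z (σ r)) = f z) ∧
  (∀ (i : Fin α) (z : Fin α → ℂ), f (Function.update z i (z i + 1)) = f z) ∧
  (∀ (i : Fin α) (z : Fin α → ℂ),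
    f (Function.update z i (z i + τ)) =
      (-1) ^ n * Complex.exp (-2 * Real.pi * Complex.I * n * z i) * f z)

/-- The defining formula for the product `f ∗ g` on the open set where
`θ (z i − z j) ≠ 0` for `i ≠ j`. -/
noncomputable def starFormula (θ : ℂ → ℂ) (n : ℕ) (η : ℂ) (α β : ℕ)
    (f : (Fin α → ℂ) → ℂ) (g : (Fin β → ℂ) → ℂ) (z : Fin (α + β) → ℂ) : ℂ :=
  (1 / ((α.factorial : ℂ) * (β.factorial : ℂ))) *
    ∑ σ : Equiv.Perm (Fin (α + β)),
      f (fun r : Fin α => z (σ (Fin.castAdd β r)) + (β : ℂ) * η) *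
        g (fun s : Fin β => z (σ (Fin.natAdd α s)) - (α : ℂ) * η) *
        ∏ r : Fin α, ∏ s : Fin β,
          θ (z (σ (Fin.castAdd β r)) - z (σ (Fin.natAdd α s)) - (n : ℂ) * η) /
            θ (z (σ (Fin.castAdd β r)) - z (σ (Fin.natAdd α s)))

section
open Complex

lemma div_one_var {N P : ℂ → ℂ} (hN : Differentiable ℂ N) (hP : Differentiable ℂ P)
    (hs : ∀ z, P z = 0 → deriv P z ≠ 0) (hv : ∀ z, P z = 0 → N z = 0) :
    ∃ G : ℂ → ℂ, Differentiable ℂ G ∧ ∀ z, N z = P z * G z := by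
  classical
  refine ⟨fun z => if P z = 0 then deriv N z / deriv P z else N z / P z, ?_, ?_⟩
  · intro z₀
    by_cases h0 : P z₀ = 0
    · have dN : Differentiable ℂ (dslope N z₀) := by
        rw [← differentiableOn_univ, Complex.differentiableOn_dslope Filter.univ_mem]
        exact hN.differentiableOn
      have dP : Differentiable ℂ (dslope P z₀) := by
        rw [← differentiableOn_univ, Complex.differentiableOn_dslope Filter.univ_mem]
        exact hP.differentiableOn
      have hne : dslope P z₀ z₀ ≠ 0 := by rw [dslope_same]; exact hs _ h0
      have hd : DifferentiableAt ℂ (fun z => dslope N z₀ z / dslope P z₀ z) z₀ :=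
        (dN z₀).div (dP z₀) hne
      refine hd.congr_of_eventuallyEq ?_
      filter_upwards [(dP z₀).continuousAt.eventually_ne hne] with z hz
      by_cases hzz : z = z₀
      · subst hzz
        simp [h0]
      · have e1 : N z = (z - z₀) * dslope N z₀ z := by
          have := sub_smul_dslope N z₀ z
          rw [hv _ h0, sub_zero, smul_eq_mul] at this
          exact this.symm
        have e2 : P z = (z - z₀) * dslope P z₀ z := by
          have := sub_smul_dslope P z₀ z
          rw [h0, sub_zero, smul_eq_mul] at this
          exact this.symm
        have hz' : z - z₀ ≠ 0 := sub_ne_zero.2 hzz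
        have : P z ≠ 0 := by rw [e2]; exact mul_ne_zero hz' hz
        rw [if_neg this, e1, e2]
        field_simp
    · refine ((hN z₀).div (hP z₀) h0).congr_of_eventuallyEq ?_
      filter_upwards [(hP z₀).continuousAt.eventually_ne h0] with z hz
      simp [hz]
  · intro z
    by_cases h0 : P z = 0
    · simp [h0, hv z h0]
    · simp only [h0, if_false]; field_simp

lemma per_int {X : Type*} {H : ℂ → X} {p : ℂ} (h : ∀ z, H (z + p) = H z) (k : ℤ) (z : ℂ) :
    H (z + k * p) = H z := by
  have : Function.Periodic H p := h
  exact this.int_mul k z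

lemma liouville_elliptic {H : ℂ → ℂ} {τ : ℂ} (hτ : 0 < τ.im) (hH : Differentiable ℂ H)
    (h1 : ∀ z, H (z + 1) = H z) (h2 : ∀ z, H (z + τ) = H z) (z w : ℂ) : H z = H w := by
  apply hH.apply_eq_apply_of_bounded
  have hK : IsCompact ((fun p : ℝ × ℝ => H (p.1 + p.2 * τ)) '' (Set.Icc 0 1 ×ˢ Set.Icc 0 1)) := by
    apply (isCompact_Icc.prod isCompact_Icc).image
    have := hH.continuous
    fun_prop
  refine hK.isBounded.subset ?_
  rintro _ ⟨z, rfl⟩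
  set y : ℝ := z.im / τ.im with hy
  set x : ℝ := z.re - y * τ.re with hx
  have hz : z = x + y * τ := by
    apply Complex.ext
    · simp [hx]
    · simp [hy, hτ.ne']
  refine ⟨(Int.fract x, Int.fract y), ⟨⟨Int.fract_nonneg _, (Int.fract_lt_one _).le⟩,
    ⟨Int.fract_nonneg _, (Int.fract_lt_one _).le⟩⟩, ?_⟩
  have e : z = ((Int.fract x : ℝ) + (Int.fract y : ℝ) * τ + (⌊y⌋ : ℤ) * τ) + (⌊x⌋ : ℤ) * 1 := by
    rw [hz]
    conv_lhs => rw [← Int.fract_add_floor x, ← Int.fract_add_floor y]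
    push_cast
    ring
  conv_rhs => rw [e]
  rw [per_int h1, per_int h2]

/-- the q-Pochhammer symbol -/
noncomputable def qphi (q w : ℂ) : ℂ := ∏' n : ℕ, (1 + -(q ^ n * w))

lemma qphi_summable {q : ℂ} (hq : ‖q‖ < 1) (w : ℂ) : Summable fun n : ℕ => ‖-(q ^ n * w)‖ := by
  simp only [norm_neg, norm_mul, norm_pow]
  exact (summable_geometric_of_lt_one (norm_nonneg _) hq).mul_right _

lemma qphi_diff {q : ℂ} (hq : ‖q‖ < 1) : Differentiable ℂ (qphi q) := by
  have : HasProdLocallyUniformlyOn (fun (n : ℕ) w => 1 + -(q ^ n * w)) (qphi q) Set.univ := by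
    apply hasProdLocallyUniformlyOn_of_forall_compact isOpen_univ
    intro K _ hcK
    obtain ⟨C, hC⟩ := hcK.isBounded.exists_norm_le
    refine ((summable_geometric_of_lt_one (norm_nonneg _) hq).mul_right
      C).hasProdUniformlyOn_nat_one_add hcK (.of_forall fun n x hx ↦ ?_) (fun _ ↦ by fun_prop)
    simp only [norm_neg, norm_mul, norm_pow]
    gcongr
    exact hC x hx
  rw [← differentiableOn_univ]
  refine this.differentiableOn (.of_forall fun s ↦ ?_) isOpen_univ
  simpa [Finset.prod_fn] using
      DifferentiableOn.finsetProd (𝕜 := ℂ) (u := s) (s := Set.univ)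
        (f := fun (n : ℕ) w => 1 + -(q ^ n * w)) (fun _ _ ↦ by fun_prop)

lemma qphi_succ {q : ℂ} (hq : ‖q‖ < 1) (w : ℂ) : qphi q w = (1 - w) * qphi q (q * w) := by
  unfold qphi
  have hm : Multipliable fun n : ℕ => (1 + -(q ^ (n+1) * w)) := by
    apply multipliable_one_add_of_summable
    exact (summable_nat_add_iff 1).mpr (qphi_summable hq w)
  rw [tprod_eq_zero_mul' (f := fun n : ℕ => (1 + -(q ^ n * w))) hm]
  simp [pow_succ, mul_assoc, sub_eq_add_neg]

lemma qphi_zero {q : ℂ} (hq : ‖q‖ < 1) {w : ℂ} (h : qphi q w = 0) : ∃ n : ℕ, q ^ n * w = 1 := by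
  by_contra! hc
  refine tprod_one_add_ne_zero_of_summable (f := fun n => -(q ^ n * w)) ?_ (qphi_summable hq w) h
  intro i hi
  apply hc i
  linear_combination -hi

lemma cancel_simple {P A B : ℂ → ℂ} (hP : Differentiable ℂ P)
    (hs : ∀ z, P z = 0 → deriv P z ≠ 0) (hA : Continuous A) (hB : Continuous B)
    (h : ∀ z, P z * A z = P z * B z) (z : ℂ) : A z = B z := by
  by_cases h0 : P z = 0
  · have hev : ∀ᶠ w in nhdsWithin z {z}ᶜ, A w = B w := by
      filter_upwards [(hP z).hasDerivAt.eventually_ne (c := 0) (hs z h0)] with w hw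
      exact mul_left_cancel₀ hw (h w)
    have t1 : Filter.Tendsto A (nhdsWithin z {z}ᶜ) (nhds (A z)) := hA.continuousAt.mono_left nhdsWithin_le_nhds
    have t2 : Filter.Tendsto B (nhdsWithin z {z}ᶜ) (nhds (B z)) := hB.continuousAt.mono_left nhdsWithin_le_nhds
    exact tendsto_nhds_unique (t1.congr' hev) t2
  · exact mul_left_cancel₀ h0 (h z)

/-- exp (2 π i z) -/
noncomputable def ee (z : ℂ) : ℂ := Complex.exp (2 * Real.pi * Complex.I * z)

lemma ee_add (z w : ℂ) : ee (z + w) = ee z * ee w := by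
  unfold ee; rw [← Complex.exp_add]; ring_nf

lemma ee_ne (z : ℂ) : ee z ≠ 0 := Complex.exp_ne_zero _

lemma ee_neg (z : ℂ) : ee (-z) = (ee z)⁻¹ := by
  unfold ee; rw [← Complex.exp_neg]; ring_nf

lemma ee_zero : ee 0 = 1 := by simp [ee]

lemma ee_one : ee 1 = 1 := by simp [ee, Complex.exp_two_pi_mul_I]

lemma ee_hasDeriv (z : ℂ) : HasDerivAt ee (2 * Real.pi * Complex.I * ee z) z := by
  have : HasDerivAt (fun z : ℂ => 2 * Real.pi * Complex.I * z) (2 * Real.pi * Complex.I) z := by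
    simpa using (hasDerivAt_id z).const_mul (2 * Real.pi * Complex.I)
  have h2 := this.cexp
  rw [mul_comm (Complex.exp _)] at h2
  exact h2

lemma ee_diff : Differentiable ℂ ee := fun z => (ee_hasDeriv z).differentiableAt

lemma ee_nat_mul (n : ℕ) (z : ℂ) : ee (n * z) = ee z ^ n := by
  unfold ee; rw [← Complex.exp_nat_mul]; ring_nf

lemma ee_eq_one {z : ℂ} (h : ee z = 1) : ∃ m : ℤ, z = m := by
  obtain ⟨m, hm⟩ := Complex.exp_eq_one_iff.1 h
  refine ⟨m, ?_⟩
  have : (2 * Real.pi * Complex.I : ℂ) ≠ 0 := Complex.two_pi_I_ne_zero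
  apply mul_left_cancel₀ this
  rw [hm]; ring

lemma ee_norm {τ : ℂ} (hτ : 0 < τ.im) : ‖ee τ‖ < 1 := by
  have := UpperHalfPlane.norm_exp_two_pi_I_lt_one ⟨τ, hτ⟩
  simpa [ee] using this

/-- the product theta function -/
noncomputable def PP (τ z : ℂ) : ℂ := qphi (ee τ) (ee z) * qphi (ee τ) (ee τ * ee (-z))


lemma PP_diff {τ : ℂ} (hτ : 0 < τ.im) : Differentiable ℂ (PP τ) := by
  have h1 := qphi_diff (ee_norm hτ)
  have h2 := ee_diff
  unfold PP
  exact (h1.comp h2).mul (h1.comp ((h2.comp differentiable_neg).const_mul _))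

lemma PP_one {τ : ℂ} (_ : 0 < τ.im) (z : ℂ) : PP τ (z + 1) = PP τ z := by
  unfold PP
  have : ee (-(z+1)) = ee (-z) := by rw [ee_neg, ee_neg, ee_add, ee_one, mul_one]
  rw [this, ee_add, ee_one, mul_one]

lemma PP_eq {τ : ℂ} (hτ : 0 < τ.im) (z : ℂ) : PP τ z = (1 - ee z) * (qphi (ee τ) (ee τ * ee z) *
    qphi (ee τ) (ee τ * ee (-z))) := by
  unfold PP
  rw [qphi_succ (ee_norm hτ)]; ring

lemma PP_tau {τ : ℂ} (hτ : 0 < τ.im) (z : ℂ) : PP τ (z + τ) = -ee (-z) * PP τ z := by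
  rw [PP_eq hτ z, PP]
  have : ee τ * ee (-(z + τ)) = ee (-z) := by
    rw [← ee_add]; ring_nf
  rw [this, qphi_succ (ee_norm hτ) (ee (-z)), add_comm, ee_add, ee_neg]
  have := ee_ne z
  field_simp
  ring

lemma PP_neg {τ : ℂ} (hτ : 0 < τ.im) (z : ℂ) : PP τ (-z) = -ee (-z) * PP τ z := by
  rw [PP_eq hτ z, PP_eq hτ (-z), neg_neg, ee_neg]
  have := ee_ne z
  field_simp
  ring

lemma PP_zero {τ : ℂ} (hτ : 0 < τ.im) : PP τ 0 = 0 := by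
  rw [PP_eq hτ]; simp [ee_zero]

lemma PP_lattice {τ : ℂ} (hτ : 0 < τ.im) {z : ℂ} (h : PP τ z = 0) : ∃ m k : ℤ, z = m + k * τ := by
  rcases mul_eq_zero.1 h with h | h
  · obtain ⟨n, hn⟩ := qphi_zero (ee_norm hτ) h
    rw [← ee_nat_mul, ← ee_add] at hn
    obtain ⟨m, hm⟩ := ee_eq_one hn
    exact ⟨m, -n, by push_cast; linear_combination hm⟩
  · obtain ⟨n, hn⟩ := qphi_zero (ee_norm hτ) h
    rw [← ee_nat_mul, ← ee_add, ← ee_add] at hn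
    obtain ⟨m, hm⟩ := ee_eq_one hn
    exact ⟨-m, n + 1, by push_cast; linear_combination -hm⟩

lemma PP_deriv_zero {τ : ℂ} (hτ : 0 < τ.im) : deriv (PP τ) 0 ≠ 0 := by
  have hq := ee_norm hτ
  set B : ℂ → ℂ := fun z => qphi (ee τ) (ee τ * ee z) * qphi (ee τ) (ee τ * ee (-z)) with hB
  have hBd : Differentiable ℂ B :=
    ((qphi_diff hq).comp (ee_diff.const_mul _)).mul
      ((qphi_diff hq).comp ((ee_diff.comp differentiable_neg).const_mul _))
  have e : PP τ = fun z => (1 - ee z) * B z := funext (PP_eq hτ)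
  have hd := ((ee_hasDeriv 0).const_sub 1).mul (hBd 0).hasDerivAt
  have e2 := hd.deriv
  rw [show ((fun x => 1 - ee x) * B) = PP τ from e.symm] at e2
  rw [e2]
  simp only [ee_zero, sub_self, zero_mul, add_zero, mul_one]
  have hphi : qphi (ee τ) (ee τ) ≠ 0 := by
    intro h
    obtain ⟨n, hn⟩ := qphi_zero hq h
    have h1 : ‖ee τ ^ n * ee τ‖ < 1 := by
      rw [← pow_succ, norm_pow]
      exact pow_lt_one₀ (norm_nonneg _) hq (by simp)
    rw [hn] at h1
    simp at h1
  have : B 0 ≠ 0 := by simp [hB, ee_zero, hphi]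
  exact mul_ne_zero (neg_ne_zero.2 Complex.two_pi_I_ne_zero) this

lemma PP_deriv_one {τ : ℂ} (hτ : 0 < τ.im) (z : ℂ) : deriv (PP τ) (z + 1) = deriv (PP τ) z := by
  rw [← deriv_comp_add_const]
  congr 1
  exact funext (PP_one hτ)

lemma PP_deriv_tau {τ : ℂ} (hτ : 0 < τ.im) (z : ℂ) : deriv (PP τ) (z + τ) =
    2 * Real.pi * Complex.I * ee (-z) * PP τ z - ee (-z) * deriv (PP τ) z := by
  rw [← deriv_comp_add_const]
  rw [funext (PP_tau hτ)]
  have h1 : HasDerivAt (fun z => ee (-z)) (-(2 * Real.pi * Complex.I * ee (-z))) z := by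
    simpa [Function.comp_def] using HasDerivAt.comp z (ee_hasDeriv (-z)) (hasDerivAt_neg z)
  have h2 := h1.neg.mul (PP_diff hτ z).hasDerivAt
  rw [show deriv (fun z => -ee (-z) * PP τ z) z = _ from h2.deriv]
  simp only [Pi.neg_apply]
  ring

lemma PP_simple {τ : ℂ} (hτ : 0 < τ.im) {z : ℂ} (h : PP τ z = 0) : deriv (PP τ) z ≠ 0 := by
  obtain ⟨m, k, rfl⟩ := PP_lattice hτ h
  let Q : ℂ → Prop := fun z => PP τ z = 0 ∧ deriv (PP τ) z ≠ 0
  have q1 : ∀ z, Q (z + 1) = Q z := by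
    intro z; simp only [Q, PP_one hτ, PP_deriv_one hτ]
  have q2 : ∀ z, Q (z + τ) = Q z := by
    intro z
    simp only [Q, PP_tau hτ, PP_deriv_tau hτ, eq_iff_iff]
    have := ee_ne (-z)
    constructor
    · rintro ⟨a, b⟩
      have a' : PP τ z = 0 := by simpa [this] using a
      simp [a'] at b
      tauto
    · rintro ⟨a, b⟩
      simp [a, b, this]
  have : Q (m + k * τ) = Q 0 := by
    rw [per_int q2, ← zero_add (m : ℂ), ← mul_one (m : ℂ), per_int q1]
  exact (this.mpr ⟨PP_zero hτ, PP_deriv_zero hτ⟩).2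

theorem theta_eq_PP {τ : ℂ} (hτ : 0 < τ.im) {θ : ℂ → ℂ}
    (hθdiff : Differentiable ℂ θ)
    (hθ1 : ∀ z, θ (z + 1) = θ z)
    (hθτ : ∀ z, θ (z + τ) = -ee (-z) * θ z) :
    ∃ b : ℂ, ∀ z, θ z = b * PP τ z := by
  set d := deriv (PP τ) 0 with hd
  have hd0 : d ≠ 0 := PP_deriv_zero hτ
  set c := θ 0 with hc
  set N : ℂ → ℂ := fun z => d * θ z - c * deriv (PP τ) z with hN
  have hPd := PP_diff hτ
  have hNd : Differentiable ℂ N :=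
    (hθdiff.const_mul d).sub ((hPd.deriv).const_mul c)
  have hN1 : ∀ z, N (z + 1) = N z := by
    intro z; simp only [hN, hθ1, PP_deriv_one hτ]
  have hNτ : ∀ z, N (z + τ) = -ee (-z) * (N z + 2 * Real.pi * Complex.I * c * PP τ z) := by
    intro z; simp only [hN, hθτ, PP_deriv_tau hτ]; ring
  have hNz : ∀ z, PP τ z = 0 → N z = 0 := by
    intro z h
    obtain ⟨m, k, rfl⟩ := PP_lattice hτ h
    let Q : ℂ → Prop := fun z => PP τ z = 0 ∧ N z = 0
    have q1 : ∀ z, Q (z + 1) = Q z := by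
      intro z; simp only [Q, PP_one hτ, hN1]
    have q2 : ∀ z, Q (z + τ) = Q z := by
      intro z
      simp only [Q, PP_tau hτ, hNτ, eq_iff_iff]
      have := ee_ne (-z)
      constructor
      · rintro ⟨a, b⟩
        have a' : PP τ z = 0 := by simpa [this] using a
        simp [a', this] at b
        tauto
      · rintro ⟨a, b⟩
        simp [a, b]
    have : Q (m + k * τ) = Q 0 := by
      rw [per_int q2, ← zero_add (m : ℂ), ← mul_one (m : ℂ), per_int q1]
    refine (this.mpr ⟨PP_zero hτ, ?_⟩).2
    simp only [hN, ← hd, ← hc]; ring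
  obtain ⟨G, hG, hNG⟩ := div_one_var hNd hPd (fun z => PP_simple hτ) hNz
  have hG1 : ∀ z, G (z + 1) = G z := by
    apply cancel_simple hPd (fun z => PP_simple hτ)
    · exact hG.continuous.comp (continuous_add_const 1)
    · exact hG.continuous
    · intro z
      rw [← hNG, ← PP_one hτ, ← hNG, hN1]
  have hGτ : ∀ z, G (z + τ) = G z + 2 * Real.pi * Complex.I * c := by
    apply cancel_simple hPd (fun z => PP_simple hτ)
    · exact hG.continuous.comp (continuous_add_const τ)
    · exact hG.continuous.add continuous_const
    · intro z
      have h1 := hNτ z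
      rw [hNG, hNG, PP_tau hτ] at h1
      have := ee_ne (-z)
      apply mul_left_cancel₀ (neg_ne_zero.2 this)
      linear_combination h1
  have hdG1 : ∀ z, deriv G (z + 1) = deriv G z := by
    intro z
    rw [← deriv_comp_add_const, funext hG1]
  have hdGτ : ∀ z, deriv G (z + τ) = deriv G z := by
    intro z
    rw [← deriv_comp_add_const, funext hGτ]
    simp
  have hdc := liouville_elliptic hτ hG.deriv hdG1 hdGτ
  set a := deriv G 0 with ha
  have hK : ∀ z, G z - a * z = G 0 - a * 0 := by
    intro z
    refine is_const_of_deriv_eq_zero (f := fun z => G z - a * z) (hG.sub (differentiable_id.const_mul a)) ?_ z 0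
    intro z
    have := (hG z).hasDerivAt.sub ((hasDerivAt_id z).const_mul a)
    rw [show deriv (fun z => G z - a * z) z = _ from this.deriv, hdc z 0]
    simp [ha]
  have ha0 : a = 0 := by
    have h1 := hK 1
    have h2 := hG1 0
    rw [zero_add] at h2
    rw [h2] at h1
    linear_combination -h1
  have hGc : ∀ z, G z = G 0 := by
    intro z; have := hK z; rw [ha0] at this; simpa using this
  have hc0 : c = 0 := by
    have h2 := hGτ 0
    rw [hGc (0 + τ)] at h2
    have h3 : 2 * Real.pi * Complex.I * c = 0 := by linear_combination -h2
    exact (mul_eq_zero.1 h3).resolve_left Complex.two_pi_I_ne_zero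
  refine ⟨G 0 / d, fun z => ?_⟩
  have h1 := hNG z
  simp only [hN, hc0, hGc z] at h1
  field_simp
  linear_combination h1



open MeasureTheory in
lemma param_integral {ι : Type*} [Fintype ι] [DecidableEq ι] {Ψ : (ι → ℂ) → ℝ → ℂ} {z₀ : ι → ℂ}
    {R M : ℝ} (hR : 0 < R) (hc : ∀ z ∈ Metric.ball z₀ R, Continuous (Ψ z))
    (hd : ∀ s, DifferentiableOn ℂ (fun z => Ψ z s) (Metric.ball z₀ R))
    (hb : ∀ z ∈ Metric.ball z₀ R, ∀ s, ‖Ψ z s‖ ≤ M) (a b : ℝ) (hab : a ≤ b) :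
    DifferentiableAt ℂ (fun z => ∫ s in a..b, Ψ z s) z₀ := by
  have hz₀ : z₀ ∈ Metric.ball z₀ R := Metric.mem_ball_self hR
  have hda : ∀ s, DifferentiableAt ℂ (fun z => Ψ z s) z₀ := fun s =>
    (hd s).differentiableAt (Metric.ball_mem_nhds _ hR)
  have hM : 0 ≤ M := (norm_nonneg _).trans (hb z₀ hz₀ 0)
  set F' : ℝ → (ι → ℂ) →L[ℂ] ℂ := fun s => fderiv ℂ (fun z => Ψ z s) z₀ with hF'
  have hmeas : ∀ i, StronglyMeasurable (fun s => F' s (Pi.single i 1)) := by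
    intro i
    let c : ℕ → ℂ := fun n => (((n : ℝ) + 1) * (2 / R) : ℝ)
    have hcn : ∀ n, ‖c n‖ = ((n : ℝ) + 1) * (2 / R) := by
      intro n
      simp only [c, Complex.norm_real]
      exact Real.norm_of_nonneg (by positivity)
    have hcinf : Filter.Tendsto (fun n => ‖c n‖) Filter.atTop Filter.atTop := by
      simp_rw [hcn]
      exact (Filter.tendsto_atTop_add_const_right _ _ tendsto_natCast_atTop_atTop).atTop_mul_const
        (by positivity)
    refine stronglyMeasurable_of_tendsto (u := Filter.atTop)
      (f := fun n s => c n • (Ψ (z₀ + (c n)⁻¹ • Pi.single i 1) s - Ψ z₀ s)) ?_ ?_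
    · intro n
      have hmem : z₀ + (c n)⁻¹ • Pi.single i (1:ℂ) ∈ Metric.ball z₀ R := by
        simp only [Metric.mem_ball, dist_self_add_left, norm_smul, norm_inv, hcn, Pi.norm_single,
          norm_one, mul_one]
        rw [inv_lt_comm₀ (by positivity) hR]
        have : (0:ℝ) ≤ n := Nat.cast_nonneg n
        have h3 : R⁻¹ > 0 := by positivity
        rw [div_eq_mul_inv]
        nlinarith [mul_nonneg this h3.le]
      exact (((hc _ hmem).sub (hc _ hz₀)).const_smul (c n)).stronglyMeasurable
    · rw [tendsto_pi_nhds]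
      intro s
      exact (hda s).hasFDerivAt.lim _ hcinf
  have hF'meas : StronglyMeasurable F' := by
    have : F' = fun s => ∑ i, (F' s (Pi.single i 1)) • (ContinuousLinearMap.proj i : (ι → ℂ) →L[ℂ] ℂ) := by
      funext s
      ext v
      conv_lhs => rw [pi_eq_sum_univ' v]
      simp [map_sum, mul_comm]
    rw [this]
    refine Finset.stronglyMeasurable_fun_sum _ fun i _ => (hmeas i).smul_const _
  have key := hasFDerivAt_integral_of_dominated_loc_of_lip (𝕜 := ℂ)
    (μ := volume.restrict (Set.Ioc a b)) (F := Ψ) (x₀ := z₀) (F' := F')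
    (bound := fun _ => (M + M) / (R/2)) (s := Metric.ball z₀ (R/4))
    (Metric.ball_mem_nhds _ (by positivity))
    (by
      filter_upwards [Metric.ball_mem_nhds z₀ hR] with z hz
      exact (hc z hz).aestronglyMeasurable)
    ((hc z₀ hz₀).integrableOn_Ioc)
    hF'meas.aestronglyMeasurable
    (by
      refine Filter.Eventually.of_forall fun s => ?_
      apply LipschitzOnWith.of_dist_le_mul
      intro x hx y hy
      have hsub : Metric.ball y (R/2) ⊆ Metric.ball z₀ R := by
        apply Metric.ball_subset_ball'
        have := Metric.mem_ball.1 hy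
        linarith
      have hxy : x ∈ Metric.ball y (R/2) := by
        have h1 := Metric.mem_ball.1 hy
        have h2 := Metric.mem_ball.1 hx
        have := dist_triangle_right x y z₀
        rw [Metric.mem_ball]
        linarith
      have := Complex.dist_le_div_mul_dist_of_mapsTo_ball (f := fun z => Ψ z s) (R₂ := M + M)
        ((hd s).mono hsub) (by
          intro w hw
          rw [Metric.mem_closedBall, dist_eq_norm]
          refine (norm_sub_le _ _).trans (add_le_add (hb _ (hsub hw) _) (hb _ (hsub ?_) _))
          exact Metric.mem_ball_self (by positivity)) hxy
      refine this.trans (le_of_eq ?_)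
      congr 1
      simp only [Real.coe_nnabs]
      rw [abs_of_nonneg]
      positivity)
    (by simp)
    (Filter.Eventually.of_forall fun s => (hda s).hasFDerivAt)
  have := key.2.differentiableAt
  simpa only [intervalIntegral.integral_of_le hab] using this

lemma div_multi {ι : Type*} [Fintype ι] [DecidableEq ι] {F : (ι → ℂ) → ℂ} (hF : Differentiable ℂ F)
    {T : ℂ → ℂ} (hT : Differentiable ℂ T) (hs : ∀ z, T z = 0 → deriv T z ≠ 0) {i j : ι}
    (hij : i ≠ j) (hv : ∀ z : ι → ℂ, T (z i - z j) = 0 → F z = 0) :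
    ∃ G : (ι → ℂ) → ℂ, Differentiable ℂ G ∧ ∀ z, F z = T (z i - z j) * G z := by
  set v : ι → ℂ := Pi.single i 1 with hvdef
  have hvi : v i = 1 := by simp [hvdef]
  have hvj : v j = 0 := by simp [hvdef, hij.symm]
  have hdiff : ∀ z : ι → ℂ, ∀ t : ℂ, (z + t • v) i - (z + t • v) j = z i - z j + t := by
    intro z t; simp [hvi, hvj]; ring
  have h1 : ∀ z : ι → ℂ, ∃ q : ℂ → ℂ, Differentiable ℂ q ∧
      ∀ t, F (z + t • v) = T (z i - z j + t) * q t := by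
    intro z
    refine div_one_var (N := fun t => F (z + t • v)) (P := fun t => T (z i - z j + t)) ?_ ?_ ?_ ?_
    · exact hF.comp (by fun_prop)
    · exact hT.comp (by fun_prop)
    · intro t ht
      rw [deriv_comp_const_add]
      exact hs _ ht
    · intro t ht
      apply hv
      rw [hdiff]; exact ht
  choose q hq hFq using h1
  refine ⟨fun z => q z 0, ?_, ?_⟩
  swap
  · intro z
    have := hFq z 0
    simpa using this
  intro z₀
  set w₀ := z₀ i - z₀ j with hw₀
  -- choose radius
  obtain ⟨r, hr, hrne⟩ : ∃ r > 0, ∀ t : ℂ, ‖t‖ = r → T (w₀ + t) ≠ 0 := by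
    have hev : ∀ᶠ w in nhdsWithin w₀ {w₀}ᶜ, T w ≠ 0 := by
      by_cases h0 : T w₀ = 0
      · exact (hT w₀).hasDerivAt.eventually_ne (hs _ h0)
      · exact ((hT w₀).continuousAt.eventually_ne h0).filter_mono nhdsWithin_le_nhds
    rw [eventually_nhdsWithin_iff, Metric.eventually_nhds_iff] at hev
    obtain ⟨ε, hε, H⟩ := hev
    refine ⟨ε/2, by positivity, fun t ht => H ?_ ?_⟩
    · simp [ht]; linarith
    · have : t ≠ 0 := by rintro rfl; simp at ht; linarith
      simpa using this
  set Φ : (ι → ℂ) → ℂ → ℂ := fun z t => F (z + t • v) / T (z i - z j + t) with hΦ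
  have hK := isCompact_sphere (0:ℂ) r
  have hFc := hF.continuous
  have hTc := hT.continuous
  have ev1 : ∀ᶠ z in nhds z₀, ∀ t ∈ Metric.sphere (0:ℂ) r, T (z i - z j + t) ≠ 0 := by
    apply hK.eventually_forall_of_forall_eventually
    intro t ht
    have : ContinuousAt (fun p : (ι → ℂ) × ℂ => T (p.1 i - p.1 j + p.2)) (z₀, t) := by fun_prop
    exact this.eventually_ne (hrne t (by simpa using ht))
  obtain ⟨M, hM⟩ : ∃ M, ∀ t ∈ Metric.sphere (0:ℂ) r, ‖Φ z₀ t‖ < M := by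
    have hcont : ContinuousOn (fun t => Φ z₀ t) (Metric.sphere (0:ℂ) r) := by
      apply ContinuousOn.div
      · fun_prop
      · fun_prop
      · intro t ht; exact hrne t (by simpa using ht)
    obtain ⟨C, hC⟩ := hK.exists_bound_of_continuousOn hcont
    exact ⟨C + 1, fun t ht => (hC t ht).trans_lt (by linarith)⟩
  have ev2 : ∀ᶠ z in nhds z₀, ∀ t ∈ Metric.sphere (0:ℂ) r, ‖Φ z t‖ < M := by
    apply hK.eventually_forall_of_forall_eventually
    intro t ht
    have : ContinuousAt (fun p : (ι → ℂ) × ℂ => ‖Φ p.1 p.2‖) (z₀, t) := by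
      apply ContinuousAt.norm
      apply ContinuousAt.div
      · fun_prop
      · fun_prop
      · exact hrne t (by simpa using ht)
    exact this.eventually_lt continuousAt_const (hM t ht)
  obtain ⟨R, hR, HR⟩ := Metric.eventually_nhds_iff_ball.1 (ev1.and ev2)
  have hmem : ∀ s : ℝ, circleMap 0 r s ∈ Metric.sphere (0:ℂ) r :=
    fun s => circleMap_mem_sphere 0 hr.le s
  have hD : DifferentiableAt ℂ (fun z => ∫ s in (0:ℝ)..(2 * Real.pi), Φ z (circleMap 0 r s)) z₀ := by
    refine param_integral (M := M) hR ?_ ?_ ?_ _ _ (by positivity)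
    · intro z hz
      apply Continuous.div
      · fun_prop
      · fun_prop
      · intro s; exact (HR z hz).1 _ (hmem s)
    · intro s z hz
      apply DifferentiableAt.differentiableWithinAt
      simp only [hΦ, div_eq_mul_inv]
      apply DifferentiableAt.fun_mul
      · exact (hF _).comp z (by fun_prop)
      apply DifferentiableAt.fun_inv
      · exact DifferentiableAt.comp (g := T) z (hT _) (by fun_prop)
      · exact (HR z hz).1 _ (hmem s)
    · intro z hz s
      exact ((HR z hz).2 _ (hmem s)).le
  refine (hD.const_mul ((2 * Real.pi * I : ℂ)⁻¹ * I)).congr_of_eventuallyEq ?_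
  filter_upwards [Metric.ball_mem_nhds z₀ hR] with z hz
  have hC := Complex.two_pi_I_inv_smul_circleIntegral_sub_inv_smul_of_differentiable_on_off_countable
    (f := q z) (c := 0) (w := 0) (R := r) Set.countable_empty (by simpa using hr)
    (hq z).continuous.continuousOn (fun x _ => hq z x)
  rw [← hC, circleIntegral, smul_eq_mul, mul_assoc (2 * (Real.pi : ℂ) * I)⁻¹ I]
  congr 1
  rw [← intervalIntegral.integral_const_mul]
  apply intervalIntegral.integral_congr
  intro s _
  have hne := (HR z hz).1 _ (hmem s)
  have hcm : circleMap 0 r s ≠ 0 := circleMap_ne_center hr.ne'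
  simp only [deriv_circleMap, smul_eq_mul, hΦ, hFq z, sub_zero]
  field_simp


lemma diff_prod {κ E : Type*} [NormedAddCommGroup E] [NormedSpace ℂ E] {s : Finset κ}
    {f : κ → E → ℂ} (h : ∀ i ∈ s, Differentiable ℂ (f i)) :
    Differentiable ℂ (fun x => ∏ i ∈ s, f i x) := by
  classical
  induction s using Finset.induction_on with
  | empty => simp
  | insert a s ha ih =>
    simp only [Finset.prod_insert ha]
    exact (h a (Finset.mem_insert_self _ _)).fun_mul
      (ih fun i hi => h i (Finset.mem_insert_of_mem hi))

lemma escape {ι : Type*} {T : ℂ → ℂ} (hT : Differentiable ℂ T)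
    (hs : ∀ z, T z = 0 → deriv T z ≠ 0) (z v : ι → ℂ) (i j : ι) (hv : v i - v j ≠ 0) :
    ∀ᶠ t : ℂ in nhdsWithin 0 {0}ᶜ, T ((z + t • v) i - (z + t • v) j) ≠ 0 := by
  have e : ∀ t : ℂ, (z + t • v) i - (z + t • v) j = (z i - z j) + t * (v i - v j) := by
    intro t; simp; ring
  simp_rw [e]
  by_cases h0 : T (z i - z j) = 0
  · have h1 : HasDerivAt (fun t : ℂ => (z i - z j) + t * (v i - v j)) (v i - v j) 0 := by
      simpa using ((hasDerivAt_id (0:ℂ)).mul_const (v i - v j)).const_add (z i - z j)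
    have h2 : HasDerivAt T (deriv T (z i - z j)) ((z i - z j) + 0 * (v i - v j)) := by
      simpa using (hT (z i - z j)).hasDerivAt
    exact (h2.comp (0:ℂ) h1).eventually_ne (mul_ne_zero (hs _ h0) hv)
  · have hTc := hT.continuous
    have : ContinuousAt (fun t : ℂ => T ((z i - z j) + t * (v i - v j))) 0 := by fun_prop
    exact (this.eventually_ne (by simpa using h0)).filter_mono nhdsWithin_le_nhds

lemma line_tendsto {ι : Type*} (z v : ι → ℂ) :
    Filter.Tendsto (fun t : ℂ => z + t • v) (nhdsWithin 0 {0}ᶜ) (nhds z) := by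
  have : Continuous (fun t : ℂ => z + t • v) := by fun_prop
  have := this.tendsto 0
  simp only [zero_smul, add_zero] at this
  exact this.mono_left nhdsWithin_le_nhds

lemma div_many {N : ℕ} {T : ℂ → ℂ} (hT : Differentiable ℂ T)
    (hs : ∀ z, T z = 0 → deriv T z ≠ 0) (s : Finset (Fin N × Fin N)) :
    ∀ (_ : ∀ p ∈ s, p.1 < p.2) (F : (Fin N → ℂ) → ℂ) (_ : Differentiable ℂ F)
    (_ : ∀ p ∈ s, ∀ z : Fin N → ℂ, T (z p.1 - z p.2) = 0 → F z = 0),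
    ∃ G : (Fin N → ℂ) → ℂ, Differentiable ℂ G ∧ ∀ z, F z = (∏ p ∈ s, T (z p.1 - z p.2)) * G z := by
  induction s using Finset.induction_on with
  | empty =>
    intro _ F hF _
    exact ⟨F, hF, by simp⟩
  | insert p s hps ih =>
    intro hlt F hF hv
    have hp : p.1 < p.2 := hlt p (Finset.mem_insert_self _ _)
    obtain ⟨G, hG, hFG⟩ := div_multi hF hT hs hp.ne (hv p (Finset.mem_insert_self _ _))
    obtain ⟨H, hH, hGH⟩ := ih (fun q hq => hlt q (Finset.mem_insert_of_mem hq)) G hG (by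
      intro q hq z hz
      have hq1 : q.1 < q.2 := hlt q (Finset.mem_insert_of_mem hq)
      have hpq : p ≠ q := by rintro rfl; exact hps hq
      obtain ⟨v, hv1, hv2⟩ : ∃ v : Fin N → ℂ, v q.1 - v q.2 = 0 ∧ v p.1 - v p.2 ≠ 0 := by
        by_cases h : p.1 ≠ q.1 ∧ p.1 ≠ q.2
        · refine ⟨Pi.single p.1 1, ?_, ?_⟩
          · simp [h.1.symm, h.2.symm]
          · simp [hp.ne']
        · have h2 : p.2 ≠ q.1 ∧ p.2 ≠ q.2 := by
            by_contra h3
            apply hpq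
            apply Prod.ext
            · by_contra h4
              have h5 : p.1 = q.2 := by by_contra h5; exact h ⟨h4, h5⟩
              have h6 : p.2 = q.1 ∨ p.2 = q.2 := by by_contra h6; push Not at h6; exact h3 h6
              rcases h6 with h6 | h6
              · rw [h5, h6] at hp; exact absurd hp (not_lt.2 hq1.le)
              · rw [h5, h6] at hp; exact lt_irrefl _ hp
            · by_contra h4
              have h5 : p.2 = q.1 := by by_contra h5; exact h3 ⟨h5, h4⟩
              have h6 : p.1 = q.1 ∨ p.1 = q.2 := by by_contra h6; push Not at h6; exact h h6
              rcases h6 with h6 | h6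
              · rw [h5, h6] at hp; exact lt_irrefl _ hp
              · rw [h5, h6] at hp; exact absurd hp (not_lt.2 hq1.le)
          refine ⟨Pi.single p.2 1, ?_, ?_⟩
          · simp [h2.1.symm, h2.2.symm]
          · simp [hp.ne]
      have hev : ∀ᶠ t : ℂ in nhdsWithin 0 {0}ᶜ, G (z + t • v) = 0 := by
        filter_upwards [escape hT hs z v p.1 p.2 hv2] with t ht
        have h0 : F (z + t • v) = 0 := by
          apply hv q (Finset.mem_insert_of_mem hq)
          have : (z + t • v) q.1 - (z + t • v) q.2 = z q.1 - z q.2 := by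
            simp only [Pi.add_apply, Pi.smul_apply, smul_eq_mul]
            linear_combination t * hv1
          rw [this]; exact hz
        rw [hFG] at h0
        exact (mul_eq_zero.1 h0).resolve_left ht
      have t1 : Filter.Tendsto (fun t : ℂ => G (z + t • v)) (nhdsWithin 0 {0}ᶜ) (nhds (G z)) :=
        (hG.continuous.tendsto z).comp (line_tendsto z v)
      exact tendsto_nhds_unique (t1.congr' hev) tendsto_const_nhds)
    refine ⟨H, hH, fun z => ?_⟩
    rw [hFG, hGH, Finset.prod_insert hps, mul_assoc]

/-- the generalized Vandermonde product -/
noncomputable def Dp (T : ℂ → ℂ) (N : ℕ) (z : Fin N → ℂ) : ℂ :=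
  ∏ p ∈ Finset.univ.filter (fun p : Fin N × Fin N => p.1 < p.2), T (z p.1 - z p.2)

lemma Dp_ne_iff {T : ℂ → ℂ} {N : ℕ} {z : Fin N → ℂ} :
    Dp T N z ≠ 0 ↔ ∀ i j, i < j → T (z i - z j) ≠ 0 := by
  simp [Dp, Finset.prod_ne_zero_iff]

lemma Dp_diff {T : ℂ → ℂ} (hT : Differentiable ℂ T) (N : ℕ) : Differentiable ℂ (Dp T N) := by
  unfold Dp
  apply diff_prod
  intro p _
  exact hT.comp (by fun_prop)

lemma Dp_dense {T : ℂ → ℂ} (hT : Differentiable ℂ T)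
    (hs : ∀ z, T z = 0 → deriv T z ≠ 0) (N : ℕ) : Dense {z | Dp T N z ≠ 0} := by
  have : {z | Dp T N z ≠ 0} =
      ⋂ p : {p : Fin N × Fin N // p.1 < p.2}, {z : Fin N → ℂ | T (z p.1.1 - z p.1.2) ≠ 0} := by
    ext z
    simp only [Set.mem_ofPred_eq, Dp_ne_iff, Set.mem_iInter]
    exact ⟨fun h p => h _ _ p.2, fun h i j hij => h ⟨(i, j), hij⟩⟩
  rw [this]
  apply dense_iInter_of_isOpen
  · intro p
    have hTc := hT.continuous
    exact isOpen_ne_fun (by fun_prop) continuous_const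
  · rintro ⟨p, hp⟩ z
    refine mem_closure_of_tendsto (line_tendsto z (Pi.single p.1 1)) ?_
    exact escape hT hs z (Pi.single p.1 1) p.1 p.2 (by simp [hp.ne'])

lemma Dp_perm {T : ℂ → ℂ} (hodd : ∀ z, T (-z) = -T z) {N : ℕ} (σ : Equiv.Perm (Fin N))
    (z : Fin N → ℂ) : Dp T N (fun i => z (σ i)) = (Equiv.Perm.sign σ : ℤ) * Dp T N z := by
  have e : ∀ y : Fin N → ℂ, Dp T N y = ∏ j, ∏ i ∈ Finset.Iio j, T (y i - y j) := by
    intro y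
    unfold Dp
    rw [Finset.prod_filter, Fintype.prod_prod_type_right]
    apply Finset.prod_congr rfl
    intro j _
    rw [← Finset.prod_filter]
    apply Finset.prod_congr _ (fun _ _ => rfl)
    ext i; simp
  rw [e, e]
  have := Equiv.Perm.prod_Iio_comp_eq_sign_mul_prod σ (f := fun i j => T (z i - z j)) (by
    intro i j
    rw [← hodd, neg_sub])
  exact this

lemma Dp_shift {T B : ℂ → ℂ} {p : ℂ} (hB : Continuous B) (hB0 : ∀ w, B w ≠ 0)
    (hTB : ∀ w, T (w + p) = B w * T w) {N : ℕ} (k : Fin N) :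
    ∃ u : (Fin N → ℂ) → ℂ, Continuous u ∧ (∀ z, u z ≠ 0) ∧
      ∀ z, Dp T N (Function.update z k (z k + p)) = u z * Dp T N z := by
  have h1 : ∀ q : Fin N × Fin N, ∃ u : (Fin N → ℂ) → ℂ, Continuous u ∧ (∀ z, u z ≠ 0) ∧
      (q.1 < q.2 → ∀ z, T (Function.update z k (z k + p) q.1 - Function.update z k (z k + p) q.2) =
        u z * T (z q.1 - z q.2)) := by
    rintro ⟨i, j⟩
    by_cases hi : i = k
    · subst hi
      refine ⟨fun z => B (z i - z j), by fun_prop, fun z => hB0 _, fun hij z => ?_⟩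
      simp only [Function.update_self, Function.update_of_ne hij.ne']
      rw [← hTB]; ring_nf
    · by_cases hj : j = k
      · subst hj
        refine ⟨fun z => (B (z i - z j - p))⁻¹, ?_, fun z => inv_ne_zero (hB0 _), fun hij z => ?_⟩
        · exact Continuous.inv₀ (by fun_prop) (fun z => hB0 _)
        simp only [Function.update_self, Function.update_of_ne hi]
        have := hTB (z i - z j - p)
        rw [sub_add_cancel] at this
        rw [this, inv_mul_cancel_left₀ (hB0 _)]
        ring_nf
      · refine ⟨fun _ => 1, continuous_const, fun _ => one_ne_zero, fun _ z => ?_⟩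
        simp [Function.update_of_ne hi, Function.update_of_ne hj]
  choose u hu1 hu2 hu3 using h1
  refine ⟨fun z => ∏ q ∈ Finset.univ.filter (fun p : Fin N × Fin N => p.1 < p.2), u q z, ?_, ?_, ?_⟩
  · exact continuous_finsetProd _ (fun q _ => hu1 q)
  · intro z
    exact Finset.prod_ne_zero_iff.2 (fun q _ => hu2 q z)
  · intro z
    unfold Dp
    rw [← Finset.prod_mul_distrib]
    apply Finset.prod_congr rfl
    intro q hq
    exact hu3 q (by simpa using hq) z

lemma Dp_split (T : ℂ → ℂ) (α β : ℕ) (hT : Differentiable ℂ T) :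
    ∃ W : (Fin (α + β) → ℂ) → ℂ, Differentiable ℂ W ∧ ∀ y, Dp T (α + β) y =
      (∏ r : Fin α, ∏ s : Fin β, T (y (Fin.castAdd β r) - y (Fin.natAdd α s))) * W y := by
  classical
  set A := Finset.univ.filter (fun p : Fin (α + β) × Fin (α + β) => p.1 < p.2) with hA
  set C : Finset (Fin (α + β) × Fin (α + β)) := (Finset.univ : Finset (Fin α × Fin β)).image
    (fun q => (Fin.castAdd β q.1, Fin.natAdd α q.2)) with hC
  have hCA : C ⊆ A := by
    intro p hp
    simp only [hC, Finset.mem_image, Finset.mem_univ, true_and] at hp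
    obtain ⟨q, rfl⟩ := hp
    simp only [hA, Finset.mem_filter, Finset.mem_univ, true_and, Fin.lt_def, Fin.val_castAdd,
      Fin.val_natAdd]
    omega
  refine ⟨fun y => ∏ p ∈ A \ C, T (y p.1 - y p.2), ?_, fun y => ?_⟩
  · apply diff_prod
    intro p _
    exact hT.comp (by fun_prop)
  · unfold Dp
    rw [← Finset.prod_sdiff hCA, mul_comm]
    congr 1
    rw [hC, Finset.prod_image, Fintype.prod_prod_type]
    rintro ⟨a, b⟩ _ ⟨c, d⟩ _ h
    simpa using h


/-- a single term of the star product -/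
noncomputable def tt (κ : ℂ → ℂ) (η : ℂ) (α β : ℕ)
    (f : (Fin α → ℂ) → ℂ) (g : (Fin β → ℂ) → ℂ) (y : Fin (α + β) → ℂ) : ℂ :=
  f (fun r : Fin α => y (Fin.castAdd β r) + (β : ℂ) * η) *
    g (fun s : Fin β => y (Fin.natAdd α s) - (α : ℂ) * η) *
    ∏ r : Fin α, ∏ s : Fin β, κ (y (Fin.castAdd β r) - y (Fin.natAdd α s))

lemma tt_shift {κ : ℂ → ℂ} {η : ℂ} {α β : ℕ} {f : (Fin α → ℂ) → ℂ} {g : (Fin β → ℂ) → ℂ}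
    {A : ℂ → ℂ} {p ρ : ℂ} (hρ : ρ ≠ 0)
    (hf : ∀ (i : Fin α) (z : Fin α → ℂ), f (Function.update z i (z i + p)) = A (z i) * f z)
    (hg : ∀ (i : Fin β) (z : Fin β → ℂ), g (Function.update z i (z i + p)) = A (z i) * g z)
    (hκ : ∀ w, κ (w + p) = ρ * κ w)
    (hA1 : ∀ x, A (x + β * η) * ρ ^ β = A x) (hA2 : ∀ x, A (x - α * η) * (ρ⁻¹) ^ α = A x)
    (m : Fin (α + β)) (y : Fin (α + β) → ℂ) :
    tt κ η α β f g (Function.update y m (y m + p)) = A (y m) * tt κ η α β f g y := by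
  have hκ' : ∀ w, κ (w - p) = ρ⁻¹ * κ w := by
    intro w
    have := hκ (w - p)
    rw [sub_add_cancel] at this
    rw [this, inv_mul_cancel_left₀ hρ]
  have hne : ∀ (r : Fin α) (s : Fin β), Fin.castAdd β r ≠ Fin.natAdd α s := by
    intro r s h
    have := congrArg Fin.val h
    simp at this
    omega
  unfold tt
  refine Fin.addCases (fun r₀ => ?_) (fun s₀ => ?_) m
  · set y' := Function.update y (Fin.castAdd β r₀) (y (Fin.castAdd β r₀) + p) with hy'
    have e1 : (fun r : Fin α => y' (Fin.castAdd β r) + (β : ℂ) * η) =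
        Function.update (fun r : Fin α => y (Fin.castAdd β r) + (β : ℂ) * η) r₀
          ((fun r : Fin α => y (Fin.castAdd β r) + (β : ℂ) * η) r₀ + p) := by
      funext r
      by_cases hr : r = r₀
      · subst hr; simp [hy']; ring
      · have : Fin.castAdd β r ≠ Fin.castAdd β r₀ := by
          intro h; exact hr (Fin.castAdd_injective _ _ h)
        simp [hy', Function.update_of_ne hr, Function.update_of_ne this]
    have e2 : ∀ s : Fin β, y' (Fin.natAdd α s) = y (Fin.natAdd α s) := by
      intro s
      simp [hy', Function.update_of_ne (hne r₀ s).symm]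
    have e3 : ∀ r : Fin α, ∏ s : Fin β, κ (y' (Fin.castAdd β r) - y' (Fin.natAdd α s)) =
        (if r = r₀ then ρ ^ β else 1) *
          ∏ s : Fin β, κ (y (Fin.castAdd β r) - y (Fin.natAdd α s)) := by
      intro r
      by_cases hr : r = r₀
      · subst hr
        have : ∀ s, κ (y' (Fin.castAdd β r) - y' (Fin.natAdd α s)) =
            ρ * κ (y (Fin.castAdd β r) - y (Fin.natAdd α s)) := by
          intro s
          rw [e2, ← hκ]
          simp only [hy', Function.update_self]
          ring_nf
        simp [this, Finset.prod_mul_distrib]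
      · have : Fin.castAdd β r ≠ Fin.castAdd β r₀ := by
          intro h; exact hr (Fin.castAdd_injective _ _ h)
        simp only [e2, hr, if_false, one_mul]
        simp [hy', Function.update_of_ne this]
    simp only [e3, Finset.prod_mul_distrib, Finset.prod_ite_eq', Finset.mem_univ, if_true]
    rw [e1, hf]
    simp only [e2]
    rw [← hA1 (y (Fin.castAdd β r₀))]
    ring
  · set y' := Function.update y (Fin.natAdd α s₀) (y (Fin.natAdd α s₀) + p) with hy'
    have e1 : (fun s : Fin β => y' (Fin.natAdd α s) - (α : ℂ) * η) =
        Function.update (fun s : Fin β => y (Fin.natAdd α s) - (α : ℂ) * η) s₀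
          ((fun s : Fin β => y (Fin.natAdd α s) - (α : ℂ) * η) s₀ + p) := by
      funext r
      by_cases hr : r = s₀
      · subst hr; simp [hy']; ring
      · have : Fin.natAdd α r ≠ Fin.natAdd α s₀ := by
          intro h; exact hr (Fin.natAdd_injective _ _ h)
        simp [hy', Function.update_of_ne hr, Function.update_of_ne this]
    have e2 : ∀ r : Fin α, y' (Fin.castAdd β r) = y (Fin.castAdd β r) := by
      intro r
      simp [hy', Function.update_of_ne (hne r s₀)]
    have e3 : ∀ s : Fin β, ∏ r : Fin α, κ (y' (Fin.castAdd β r) - y' (Fin.natAdd α s)) =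
        (if s = s₀ then (ρ⁻¹) ^ α else 1) *
          ∏ r : Fin α, κ (y (Fin.castAdd β r) - y (Fin.natAdd α s)) := by
      intro s
      by_cases hr : s = s₀
      · subst hr
        have : ∀ r, κ (y' (Fin.castAdd β r) - y' (Fin.natAdd α s)) =
            ρ⁻¹ * κ (y (Fin.castAdd β r) - y (Fin.natAdd α s)) := by
          intro r
          rw [e2, ← hκ']
          simp only [hy', Function.update_self]
          ring_nf
        simp only [this, Finset.prod_mul_distrib, if_true]
        simp
      · have : Fin.natAdd α s ≠ Fin.natAdd α s₀ := by
          intro h; exact hr (Fin.natAdd_injective _ _ h)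
        simp only [e2, hr, if_false, one_mul]
        simp [hy', Function.update_of_ne this]
    rw [Finset.prod_comm]
    simp only [e3]
    rw [Finset.prod_mul_distrib, Finset.prod_ite_eq' Finset.univ s₀, if_pos (Finset.mem_univ _), e1, hg]
    simp only [e2]
    rw [← hA2 (y (Fin.natAdd α s₀)), Finset.prod_comm]
    ring

/-- symmetrization -/
noncomputable def SS (κ : ℂ → ℂ) (η : ℂ) (α β : ℕ)
    (f : (Fin α → ℂ) → ℂ) (g : (Fin β → ℂ) → ℂ) (z : Fin (α + β) → ℂ) : ℂ :=
  (1 / ((α.factorial : ℂ) * (β.factorial : ℂ))) *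
    ∑ σ : Equiv.Perm (Fin (α + β)), tt κ η α β f g (fun i => z (σ i))

lemma SS_perm (κ : ℂ → ℂ) (η : ℂ) (α β : ℕ)
    (f : (Fin α → ℂ) → ℂ) (g : (Fin β → ℂ) → ℂ) (ρ : Equiv.Perm (Fin (α + β)))
    (z : Fin (α + β) → ℂ) :
    SS κ η α β f g (fun i => z (ρ i)) = SS κ η α β f g z := by
  unfold SS
  congr 1
  exact Fintype.sum_equiv (Equiv.mulLeft ρ) _ _ (fun σ => by simp)

lemma SS_shift {κ : ℂ → ℂ} {η : ℂ} {α β : ℕ} {f : (Fin α → ℂ) → ℂ} {g : (Fin β → ℂ) → ℂ}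
    {A : ℂ → ℂ} {p ρ : ℂ} (hρ : ρ ≠ 0)
    (hf : ∀ (i : Fin α) (z : Fin α → ℂ), f (Function.update z i (z i + p)) = A (z i) * f z)
    (hg : ∀ (i : Fin β) (z : Fin β → ℂ), g (Function.update z i (z i + p)) = A (z i) * g z)
    (hκ : ∀ w, κ (w + p) = ρ * κ w)
    (hA1 : ∀ x, A (x + β * η) * ρ ^ β = A x) (hA2 : ∀ x, A (x - α * η) * (ρ⁻¹) ^ α = A x)
    (m : Fin (α + β)) (z : Fin (α + β) → ℂ) :
    SS κ η α β f g (Function.update z m (z m + p)) = A (z m) * SS κ η α β f g z := by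
  unfold SS
  rw [mul_left_comm]
  congr 1
  rw [Finset.mul_sum]
  apply Finset.sum_congr rfl
  intro σ _
  have e : (fun i => Function.update z m (z m + p) (σ i)) =
      Function.update (fun i => z (σ i)) (σ.symm m) ((fun i => z (σ i)) (σ.symm m) + p) := by
    funext i
    by_cases h : σ i = m
    · have : i = σ.symm m := by rw [← h]; simp
      subst this
      simp
    · have : i ≠ σ.symm m := by rintro rfl; simp at h
      simp [Function.update_of_ne h, Function.update_of_ne this]
  rw [e, tt_shift hρ hf hg hκ hA1 hA2]
  simp

lemma core {τ : ℂ} {κ T lam B1 Bτ A1 Aτ : ℂ → ℂ} {η ρ1 ρτ : ℂ} {α β : ℕ}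
    {f : (Fin α → ℂ) → ℂ} {g : (Fin β → ℂ) → ℂ}
    (hT : Differentiable ℂ T) (hs : ∀ z, T z = 0 → deriv T z ≠ 0)
    (hlat : ∀ z, T z = 0 → ∃ m k : ℤ, z = m + k * τ)
    (hodd : ∀ z, T (-z) = -T z)
    (hlam : Differentiable ℂ lam) (hκT : ∀ w, T w ≠ 0 → T w * κ w = lam w)
    (hB1 : Continuous B1) (hB10 : ∀ w, B1 w ≠ 0) (hTB1 : ∀ w, T (w + 1) = B1 w * T w)
    (hBτ : Continuous Bτ) (hBτ0 : ∀ w, Bτ w ≠ 0) (hTBτ : ∀ w, T (w + τ) = Bτ w * T w)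
    (hA1c : Continuous A1) (hA10 : ∀ w, A1 w ≠ 0)
    (hAτc : Continuous Aτ) (hAτ0 : ∀ w, Aτ w ≠ 0)
    (hfd : Differentiable ℂ f) (hgd : Differentiable ℂ g)
    (hρ1 : ρ1 ≠ 0)
    (hf1 : ∀ (i : Fin α) (z : Fin α → ℂ), f (Function.update z i (z i + 1)) = A1 (z i) * f z)
    (hg1 : ∀ (i : Fin β) (z : Fin β → ℂ), g (Function.update z i (z i + 1)) = A1 (z i) * g z)
    (hκ1 : ∀ w, κ (w + 1) = ρ1 * κ w)
    (hA11 : ∀ x, A1 (x + β * η) * ρ1 ^ β = A1 x) (hA12 : ∀ x, A1 (x - α * η) * (ρ1⁻¹) ^ α = A1 x)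
    (hρτ : ρτ ≠ 0)
    (hfτ : ∀ (i : Fin α) (z : Fin α → ℂ), f (Function.update z i (z i + τ)) = Aτ (z i) * f z)
    (hgτ : ∀ (i : Fin β) (z : Fin β → ℂ), g (Function.update z i (z i + τ)) = Aτ (z i) * g z)
    (hκτ : ∀ w, κ (w + τ) = ρτ * κ w)
    (hAτ1 : ∀ x, Aτ (x + β * η) * ρτ ^ β = Aτ x)
    (hAτ2 : ∀ x, Aτ (x - α * η) * (ρτ⁻¹) ^ α = Aτ x) :
    ∃ h : (Fin (α + β) → ℂ) → ℂ, Differentiable ℂ h ∧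
      (∀ z, Dp T (α + β) z ≠ 0 → h z = SS κ η α β f g z) ∧
      (∀ (σ : Equiv.Perm (Fin (α + β))) (z : Fin (α + β) → ℂ), h (fun r => z (σ r)) = h z) ∧
      (∀ i z, h (Function.update z i (z i + 1)) = A1 (z i) * h z) ∧
      (∀ i z, h (Function.update z i (z i + τ)) = Aτ (z i) * h z) := by
  have hdense := Dp_dense hT hs (α + β)
  have hext : ∀ {P Q : (Fin (α + β) → ℂ) → ℂ}, Continuous P → Continuous Q →
      (∀ z, Dp T (α + β) z ≠ 0 → P z = Q z) → ∀ z, P z = Q z := by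
    intro P Q hP hQ h z
    exact congrFun (hP.ext_on hdense hQ (fun z hz => h z hz)) z
  have hSp := SS_perm κ η α β f g
  have hS1 := SS_shift hρ1 hf1 hg1 hκ1 hA11 hA12
  have hSτ := SS_shift hρτ hfτ hgτ hκτ hAτ1 hAτ2
  set S := SS κ η α β f g with hS
  have hDd := Dp_diff hT (α + β)
  have hDp := fun (σ : Equiv.Perm (Fin (α + β))) z => Dp_perm hodd σ z
  -- construct the numerator
  obtain ⟨F, hFd, hF⟩ : ∃ F : (Fin (α + β) → ℂ) → ℂ, Differentiable ℂ F ∧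
      ∀ z, Dp T (α + β) z ≠ 0 → F z = Dp T (α + β) z * S z := by
    obtain ⟨W, hW, hWD⟩ := Dp_split T α β hT
    have hterm : ∀ σ : Equiv.Perm (Fin (α + β)), ∃ F : (Fin (α + β) → ℂ) → ℂ, Differentiable ℂ F ∧
        ∀ z, Dp T (α + β) z ≠ 0 →
          F z = Dp T (α + β) z * tt κ η α β f g (fun i => z (σ i)) := by
      intro σ
      refine ⟨fun z => ((Equiv.Perm.sign σ : ℤ) : ℂ) *
        (f (fun r : Fin α => z (σ (Fin.castAdd β r)) + (β : ℂ) * η) *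
        g (fun s : Fin β => z (σ (Fin.natAdd α s)) - (α : ℂ) * η) *
        (∏ r : Fin α, ∏ s : Fin β, lam (z (σ (Fin.castAdd β r)) - z (σ (Fin.natAdd α s)))) *
        W (fun i => z (σ i))), ?_, ?_⟩
      · refine Differentiable.const_mul (((Differentiable.fun_mul (hfd.comp ?_)
          (hgd.comp ?_)).fun_mul ?_).fun_mul (hW.comp ?_)) _
        · fun_prop
        · fun_prop
        · refine diff_prod fun r _ => diff_prod fun s _ => hlam.comp ?_
          fun_prop
        · fun_prop
      · intro z hz
        have h1 := hDp σ z
        have h2 := hWD (fun i => z (σ i))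
        have hsq : ((Equiv.Perm.sign σ : ℤ) : ℂ) * ((Equiv.Perm.sign σ : ℤ) : ℂ) = 1 := by
          rcases Int.units_eq_one_or (Equiv.Perm.sign σ) with h | h <;> simp [h]
        have hsg : ((Equiv.Perm.sign σ : ℤ) : ℂ) ≠ 0 := left_ne_zero_of_mul_eq_one hsq
        have h3 : Dp T (α + β) z = ((Equiv.Perm.sign σ : ℤ) : ℂ) *
            Dp T (α + β) (fun i => z (σ i)) := by
          rw [h1, ← mul_assoc, hsq, one_mul]
        have h4 : ∀ r s, T (z (σ (Fin.castAdd β r)) - z (σ (Fin.natAdd α s))) ≠ 0 := by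
          have h5 : Dp T (α + β) (fun i => z (σ i)) ≠ 0 := by
            rw [h1]; exact mul_ne_zero hsg hz
          rw [h2] at h5
          have h6 := left_ne_zero_of_mul h5
          intro r s
          exact Finset.prod_ne_zero_iff.1 (Finset.prod_ne_zero_iff.1 h6 r (Finset.mem_univ _)) s
            (Finset.mem_univ _)
        rw [h3, h2]
        unfold tt
        have h7 : (∏ r : Fin α, ∏ s : Fin β,
            lam (z (σ (Fin.castAdd β r)) - z (σ (Fin.natAdd α s)))) =
            (∏ r : Fin α, ∏ s : Fin β, T (z (σ (Fin.castAdd β r)) - z (σ (Fin.natAdd α s)))) *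
            (∏ r : Fin α, ∏ s : Fin β, κ (z (σ (Fin.castAdd β r)) - z (σ (Fin.natAdd α s)))) := by
          simp only [← Finset.prod_mul_distrib]
          refine Finset.prod_congr rfl fun r _ => Finset.prod_congr rfl fun s _ => ?_
          exact (hκT _ (h4 r s)).symm
        simp only [h7]
        ring
    choose Fs hFs1 hFs2 using hterm
    refine ⟨fun z => (1 / ((α.factorial : ℂ) * (β.factorial : ℂ))) * ∑ σ, Fs σ z, ?_, ?_⟩
    · exact (Differentiable.fun_sum fun σ _ => hFs1 σ).const_mul _
    · intro z hz
      simp only [hS, SS]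
      rw [mul_left_comm (Dp T (α + β) z)]
      congr 1
      rw [Finset.mul_sum]
      exact Finset.sum_congr rfl fun σ _ => hFs2 σ z hz
  have hFc := hFd.continuous
  have hupd : ∀ (i : Fin (α + β)) (p : ℂ),
      Continuous (fun z : Fin (α + β) → ℂ => Function.update z i (z i + p)) := by
    intro i p
    exact continuous_id.update i (by fun_prop)
  have hprm : ∀ σ : Equiv.Perm (Fin (α + β)),
      Continuous (fun z : Fin (α + β) → ℂ => (fun r => z (σ r))) := by
    intro σ; fun_prop
  have hFsh : ∀ (p : ℂ) (A B : ℂ → ℂ), Continuous A → (∀ w, A w ≠ 0) → Continuous B →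
      (∀ w, B w ≠ 0) → (∀ w, T (w + p) = B w * T w) →
      (∀ i z, S (Function.update z i (z i + p)) = A (z i) * S z) →
      ∀ i z, (F (Function.update z i (z i + p)) = 0) = (F z = 0) := by
    intro p A B hA hA0 hB hB0 hTB hSA i z
    obtain ⟨u, hu, hu0, hDu⟩ := Dp_shift hB hB0 hTB i
    have : ∀ z, F (Function.update z i (z i + p)) = u z * A (z i) * F z := by
      apply hext
      · exact hFc.comp (hupd i p)
      · fun_prop
      · intro z hz
        rw [hF z hz, hF _ (by rw [hDu]; exact mul_ne_zero (hu0 z) hz), hDu, hSA]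
        ring
    rw [this]
    simp [hu0 z, hA0 (z i)]
  have hF1 := hFsh 1 A1 B1 hA1c hA10 hB1 hB10 hTB1 hS1
  have hFτ := hFsh τ Aτ Bτ hAτc hAτ0 hBτ hBτ0 hTBτ hSτ
  have hFv : ∀ p ∈ Finset.univ.filter (fun p : Fin (α + β) × Fin (α + β) => p.1 < p.2),
      ∀ z : Fin (α + β) → ℂ, T (z p.1 - z p.2) = 0 → F z = 0 := by
    rintro ⟨i, j⟩ hij z hz
    have hij' : i < j := by simpa using hij
    simp only at hz
    obtain ⟨m, k, hmk⟩ := hlat _ hz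
    let Q : ℂ → Prop := fun x => F (Function.update z i x) = 0
    have q1 : ∀ x, Q (x + 1) = Q x := by
      intro x
      have := hF1 i (Function.update z i x)
      simpa [Q] using this
    have q2 : ∀ x, Q (x + τ) = Q x := by
      intro x
      have := hFτ i (Function.update z i x)
      simpa [Q] using this
    have hQ : Q (z i) = Q (z j) := by
      have : z i = (z j + m * 1) + k * τ := by linear_combination hmk
      rw [this, per_int q2, per_int q1]
    have hanti : ∀ z, F (fun r => z (Equiv.swap i j r)) = -F z := by
      apply hext
      · exact hFc.comp (hprm _)
      · fun_prop
      · intro z hz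
        have hsg : Dp T (α + β) (fun r => z (Equiv.swap i j r)) = -Dp T (α + β) z := by
          rw [hDp, Equiv.Perm.sign_swap hij'.ne]; simp
        rw [hF z hz, hF _ (by rw [hsg]; exact neg_ne_zero.2 hz), hsg, hSp]
        ring
    have hQj : Q (z j) := by
      have h1 := hanti (Function.update z i (z j))
      have h2 : (fun r => Function.update z i (z j) (Equiv.swap i j r)) =
          Function.update z i (z j) := by
        funext r
        by_cases hri : r = i
        · subst hri; simp [Function.update_of_ne hij'.ne']
        · by_cases hrj : r = j
          · subst hrj; simp [Function.update_of_ne hij'.ne']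
          · rw [Equiv.swap_apply_of_ne_of_ne hri hrj]
      rw [h2] at h1
      exact self_eq_neg.1 h1
    have := hQ.mpr hQj
    simpa [Q] using this
  obtain ⟨h, hhd, hh⟩ := div_many hT hs _ (by intro p hp; simpa using hp) F hFd hFv
  have hhS : ∀ z, Dp T (α + β) z ≠ 0 → h z = S z := by
    intro z hz
    have h1 : F z = Dp T (α + β) z * h z := hh z
    rw [hF z hz] at h1
    exact (mul_left_cancel₀ hz h1).symm
  have hhc := hhd.continuous
  have hsh : ∀ (p : ℂ) (A B : ℂ → ℂ), Continuous A → Continuous B →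
      (∀ w, B w ≠ 0) → (∀ w, T (w + p) = B w * T w) →
      (∀ i z, S (Function.update z i (z i + p)) = A (z i) * S z) →
      ∀ i z, h (Function.update z i (z i + p)) = A (z i) * h z := by
    intro p A B hA hB hB0 hTB hSA i
    obtain ⟨u, hu, hu0, hDu⟩ := Dp_shift hB hB0 hTB i
    apply hext
    · exact hhc.comp (hupd i p)
    · fun_prop
    · intro z hz
      rw [hhS z hz, hhS _ (by rw [hDu]; exact mul_ne_zero (hu0 z) hz), hSA]
  refine ⟨h, hhd, hhS, ?_, hsh 1 A1 B1 hA1c hB1 hB10 hTB1 hS1, hsh τ Aτ Bτ hAτc hBτ hBτ0 hTBτ hSτ⟩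
  intro σ
  apply hext
  · exact hhc.comp (hprm σ)
  · exact hhc
  · intro z hz
    have hsg : ((Equiv.Perm.sign σ : ℤ) : ℂ) ≠ 0 := by
      rcases Int.units_eq_one_or (Equiv.Perm.sign σ) with h | h <;> simp [h]
    rw [hhS z hz, hhS _ (by rw [hDp]; exact mul_ne_zero hsg hz), hSp]

end

theorem star_product_well_defined (τ : ℂ) (hτ : 0 < τ.im) (θ : ℂ → ℂ)
    (hθdiff : Differentiable ℂ θ) (hθne : ∃ z, θ z ≠ 0)
    (hθ1 : ∀ z, θ (z + 1) = θ z)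
    (hθτ : ∀ z, θ (z + τ) = -Complex.exp (-2 * Real.pi * Complex.I * z) * θ z)
    (n : ℕ) (hn : 1 ≤ n) (η : ℂ) (α β : ℕ) (hα : 1 ≤ α) (hβ : 1 ≤ β)
    (f : (Fin α → ℂ) → ℂ) (g : (Fin β → ℂ) → ℂ)
    (hf : InThetaF τ n α f) (hg : InThetaF τ n β g) :
    ∃! h : (Fin (α + β) → ℂ) → ℂ,
      InThetaF τ n (α + β) h ∧
        ∀ z : Fin (α + β) → ℂ, (∀ i j, i ≠ j → θ (z i - z j) ≠ 0) →
          h z = starFormula θ n η α β f g z := by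
  have hθτ' : ∀ z, θ (z + τ) = -ee (-z) * θ z := by
    intro z
    rw [hθτ, ee]
    congr 3
    ring
  have hA : ∀ x : ℂ, (-1 : ℂ) ^ n * Complex.exp (-2 * Real.pi * Complex.I * n * x) =
      (-1) ^ n * ee (-(n * x)) := by
    intro x
    rw [ee]
    congr 2
    ring
  have hepd : Differentiable ℂ ee := ee_diff
  have hec : Continuous ee := hepd.continuous
  obtain ⟨b, hb⟩ := theta_eq_PP hτ hθdiff hθ1 hθτ'
  have hb0 : b ≠ 0 := by
    rintro rfl
    obtain ⟨z, hz⟩ := hθne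
    exact hz (by simp [hb])
  have hhalf : ∀ a : ℂ, ee (-(a / 2)) * ee (a / 2) = 1 := by
    intro a
    rw [← ee_add, neg_add_cancel, ee_zero]
  have heh : ee (-(1 / 2)) = -1 := by
    rw [ee, show 2 * (Real.pi : ℂ) * Complex.I * (-(1 / 2)) = -(Real.pi * Complex.I) by ring,
      Complex.exp_neg, Complex.exp_pi_mul_I]
    norm_num
  let T : ℂ → ℂ := fun z => ee (-(z / 2)) * θ z
  have hT0 : ∀ z, T z = 0 ↔ θ z = 0 := by
    intro z
    simp [T, ee_ne]
  have hP0 : ∀ z, T z = 0 → PP τ z = 0 := by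
    intro z hz
    have := (hT0 z).1 hz
    rw [hb] at this
    exact (mul_eq_zero.1 this).resolve_left hb0
  have hEd : Differentiable ℂ (fun z : ℂ => ee (-(z / 2))) :=
    hepd.comp (by fun_prop)
  have hT : Differentiable ℂ T := hEd.fun_mul hθdiff
  have hs : ∀ z, T z = 0 → deriv T z ≠ 0 := by
    intro z hz
    have h1 : deriv T z = deriv (fun z : ℂ => ee (-(z / 2))) z * θ z + ee (-(z / 2)) * deriv θ z :=
      deriv_fun_mul (hEd z) (hθdiff z)
    have h2 : deriv θ z = b * deriv (PP τ) z := by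
      have : θ = fun z => b * PP τ z := funext hb
      rw [this, deriv_const_mul_field]
    rw [h1, (hT0 z).1 hz, mul_zero, zero_add, h2]
    exact mul_ne_zero (ee_ne _) (mul_ne_zero hb0 (PP_simple hτ (hP0 z hz)))
  have hodd : ∀ z, T (-z) = -T z := by
    intro z
    simp only [T]
    rw [hb, hb, PP_neg hτ]
    have e1 : ee (-(-z / 2)) * ee (-z) = ee (-(z / 2)) := by
      rw [← ee_add]; congr 1; ring
    linear_combination (-(b * PP τ z)) * e1
  let κ : ℂ → ℂ := fun w => θ (w - n * η) / θ w
  let lam : ℂ → ℂ := fun w => ee (-(w / 2)) * θ (w - n * η)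
  have hlam : Differentiable ℂ lam :=
    hEd.fun_mul (hθdiff.comp (by fun_prop))
  have hκ1 : ∀ w, κ (w + 1) = 1 * κ w := by
    intro w
    simp only [κ]
    rw [show w + 1 - n * η = (w - n * η) + 1 by ring, hθ1, hθ1, one_mul]
  have hκτ : ∀ w, κ (w + τ) = ee (n * η) * κ w := by
    intro w
    simp only [κ]
    rw [show w + τ - n * η = (w - n * η) + τ by ring, hθτ', hθτ',
      show -(w - n * η) = n * η + -w by ring, ee_add]
    have := ee_ne (-w)
    by_cases hw : θ w = 0
    · simp [hw]
    · field_simp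
  obtain ⟨hfd, hfp, hf1, hfτ⟩ := hf
  obtain ⟨hgd, hgp, hg1, hgτ⟩ := hg
  obtain ⟨h, hhd, hhS, hhp, hh1, hhτ⟩ := core (τ := τ) (κ := κ) (T := T) (lam := lam)
    (B1 := fun _ => -1) (Bτ := fun w => -(ee (-w) * ee (-(τ / 2)))) (A1 := fun _ => 1)
    (Aτ := fun x => (-1) ^ n * ee (-(n * x))) (η := η) (ρ1 := 1) (ρτ := ee (n * η))
    (α := α) (β := β) (f := f) (g := g) hT hs
    (fun z hz => PP_lattice hτ (hP0 z hz)) hodd hlam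
    (by
      intro w hw
      have : θ w ≠ 0 := fun h => hw ((hT0 w).2 h)
      simp only [T, κ, lam]
      field_simp)
    continuous_const (fun _ => by norm_num)
    (by
      intro w
      simp only [T]
      rw [hθ1, show -((w + 1) / 2) = -(w / 2) + -(1 / 2) by ring, ee_add, heh]
      ring)
    (by fun_prop) (fun w => neg_ne_zero.2 (mul_ne_zero (ee_ne _) (ee_ne _)))
    (by
      intro w
      simp only [T]
      rw [hθτ', show -((w + τ) / 2) = -(w / 2) + -(τ / 2) by ring, ee_add]
      ring)
    continuous_const (fun _ => one_ne_zero)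
    (by fun_prop) (fun w => mul_ne_zero (pow_ne_zero _ (by norm_num)) (ee_ne _))
    hfd hgd one_ne_zero (by simpa using hf1) (by simpa using hg1) hκ1 (by simp) (by simp)
    (ee_ne _) (by intro i z; rw [hfτ, hA]) (by intro i z; rw [hgτ, hA]) hκτ
    (by
      intro x
      rw [← ee_nat_mul, mul_assoc, ← ee_add]
      congr 2
      ring)
    (by
      intro x
      rw [← ee_neg, ← ee_nat_mul, mul_assoc, ← ee_add]
      congr 2
      ring)
  have hD : ∀ z : Fin (α + β) → ℂ, Dp T (α + β) z ≠ 0 ↔ ∀ i j, i ≠ j → θ (z i - z j) ≠ 0 := by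
    intro z
    rw [Dp_ne_iff]
    constructor
    · intro hz i j hij h0
      rcases lt_or_gt_of_ne hij with hlt | hlt
      · exact hz i j hlt ((hT0 _).2 h0)
      · refine hz j i hlt ?_
        rw [← neg_sub, hodd, (hT0 _).2 h0, neg_zero]
    · intro hz i j hij h0
      exact hz i j hij.ne ((hT0 _).1 h0)
  refine ⟨h, ⟨⟨hhd, hhp, ?_, ?_⟩, ?_⟩, ?_⟩
  · intro i z
    rw [hh1, one_mul]
  · intro i z
    rw [hhτ, hA]
  · intro z hz
    exact hhS z ((hD z).2 hz)
  · rintro h' ⟨⟨hd', -⟩, hh'⟩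
    refine hd'.continuous.ext_on (Dp_dense hT hs (α + β)) hhd.continuous ?_
    intro z hz
    rw [hh' z ((hD z).1 hz), hhS z hz]
    rfl
end
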